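/- arXiv:math/0210392 — 3 statements merged into one kernel-verified Lean document; each statement's English description precedes it below -/
import Mathlib

section
/- Let X be a complete polynomial vector field on ℂ² and denote by F_X the singular holomorphic foliation induced by X on ℂℙ². If the line at infinity Δ is not invariant under F_X, then the degree of X is at most 1. -/
open Metric Set Filter Asymptotics

noncomputable section

/-! ### Basic vocabulary: vector fields on ℂ², flows, semi-complete vector fields,
the line at infinity of ℂP², separatrices and dicritical singularities, blow-ups. -/

abbrev C2 := ℂ × ℂ

/-- Determinant of two vectors of ℂ² (vanishing = collinearity). -/
def det2 (a b : C2) : ℂ := a.1 * b.2 - a.2 * b.1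

/-- Evaluation of a two-variable polynomial at a point of ℂ². -/
def pev (P : MvPolynomial (Fin 2) ℂ) (z : C2) : ℂ :=
  MvPolynomial.eval ![z.1, z.2] P

/-- A map ℂ² → ℂ² with polynomial components. -/
def IsPolyMap (σ : C2 → C2) : Prop :=
  ∃ A B : MvPolynomial (Fin 2) ℂ, ∀ z, σ z = (pev A z, pev B z)

/-- A holomorphic vector field on ℂ² is complete if it is associated to a (jointly
holomorphic) global flow `Φ : ℂ × ℂ² → ℂ²`. -/
def IsCompleteVF (X : C2 → C2) : Prop :=
  ∃ Φ : ℂ → C2 → C2,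
    (Differentiable ℂ fun q : ℂ × C2 => Φ q.1 q.2) ∧
    (∀ p, Φ 0 p = p) ∧
    (∀ t s p, Φ (t + s) p = Φ t (Φ s p)) ∧
    (∀ p, HasDerivAt (fun T => Φ T p) (X p) 0)

/-- Semi-completeness of a (meromorphic) vector field `Y` on `U` with pole set `D`:
existence of a semi-global holomorphic flow `Φ_sg : Ω ⊆ ℂ × U → U` satisfying the flow
equation at `T = 0`, the group law where defined, and the escape property: orbits
reaching the boundary of `Ω` leave every compact subset of `U \ D`. -/
def IsSemicompleteOn (Y : C2 → C2) (U D : Set C2) : Prop :=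
  ∃ (Ω : Set (ℂ × C2)) (Φ : ℂ × C2 → C2),
    IsOpen Ω ∧
    (∀ q ∈ Ω, q.2 ∈ U \ D) ∧
    (∀ p ∈ U \ D, ((0 : ℂ), p) ∈ Ω) ∧
    (∀ q ∈ Ω, Φ q ∈ U \ D) ∧
    (∀ q ∈ Ω, DifferentiableAt ℂ Φ q) ∧
    (∀ p ∈ U \ D, Φ (0, p) = p) ∧
    (∀ p ∈ U \ D, HasDerivAt (fun T : ℂ => Φ (T, p)) (Y p) 0) ∧
    (∀ T₁ T₂ p, (T₁ + T₂, p) ∈ Ω → (T₂, p) ∈ Ω → (T₁, Φ (T₂, p)) ∈ Ω →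
      Φ (T₁ + T₂, p) = Φ (T₁, Φ (T₂, p))) ∧
    (∀ (s : ℕ → ℂ × C2) (q : ℂ × C2), (∀ n, s n ∈ Ω) → q ∈ frontier Ω →
      Tendsto s atTop (nhds q) →
      ∀ K : Set C2, K ⊆ U \ D → IsCompact K → ∀ᶠ n in atTop, Φ (s n) ∉ K)

/-! Charts at infinity of ℂP² = ℂ² ∪ Δ.  In both charts the line at infinity Δ
corresponds to `{w | w.1 = 0}`; `chart1`/`chart2` send chart coordinates to affine
coordinates.  `chart1` is an involution; `chart2inv` is the inverse of `chart2`. -/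

def chart1 (w : C2) : C2 := (1 / w.1, w.2 / w.1)
def chart2 (w : C2) : C2 := (w.2 / w.1, 1 / w.1)
def chart2inv (z : C2) : C2 := (1 / z.2, z.1 / z.2)

/-- A separatrix (local analytic curve invariant by the foliation induced by `X` on ℂP²)
through the point `p` of the line at infinity, seen in the chart `ψ`. -/
def IsSepAtInf (X : C2 → C2) (ψ : C2 → C2) (p : C2) (γ : ℂ → C2) (r : ℝ) : Prop :=
  0 < r ∧ AnalyticOnNhd ℂ γ (ball (0 : ℂ) r) ∧ γ 0 = p ∧
  (∃ t ∈ ball (0 : ℂ) r, γ t ≠ p) ∧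
  ∀ t ∈ ball (0 : ℂ) r, (γ t).1 ≠ 0 →
    det2 (deriv (fun s => ψ (γ s)) t) (X (ψ (γ t))) = 0

/-- Dicritical singularity of `F_X` at the point `p` of the line at infinity:
infinitely many pairwise germwise-distinct separatrices pass through `p`. -/
def DicriticalAtInf (X : C2 → C2) (ψ : C2 → C2) (p : C2) : Prop :=
  ∃ (γ : ℕ → ℂ → C2) (r : ℕ → ℝ),
    (∀ n, IsSepAtInf X ψ p (γ n) (r n)) ∧
    ∀ m n, m ≠ n → ∀ ε > 0,
      (γ m '' ball (0 : ℂ) (r m)) ∩ ball p ε ≠ (γ n '' ball (0 : ℂ) (r n)) ∩ ball p ε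

/-- A separatrix at `p` of the (singular) foliation defined by a local vector field `Z`. -/
def IsSepAt (Z : C2 → C2) (p : C2) (γ : ℂ → C2) (r : ℝ) : Prop :=
  0 < r ∧ AnalyticOnNhd ℂ γ (ball (0 : ℂ) r) ∧ γ 0 = p ∧
  (∃ t ∈ ball (0 : ℂ) r, γ t ≠ p) ∧
  ∀ t ∈ ball (0 : ℂ) r, det2 (deriv γ t) (Z (γ t)) = 0

/-- Dicritical singularity at `p` of the foliation defined by `Z`: infinitely many
pairwise germwise-distinct separatrices through `p`. -/
def DicriticalAt (Z : C2 → C2) (p : C2) : Prop :=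
  ∃ (γ : ℕ → ℂ → C2) (r : ℕ → ℝ),
    (∀ n, IsSepAt Z p (γ n) (r n)) ∧
    ∀ m n, m ≠ n → ∀ ε > 0,
      (γ m '' ball (0 : ℂ) (r m)) ∩ ball p ε ≠ (γ n '' ball (0 : ℂ) (r n)) ∩ ball p ε

/-- `p` (in the chart `ψ` at infinity) is a regular point of the foliation induced by `X`
on ℂP²: the foliation extends as a nonvanishing holomorphic line field near `p`. -/
def RegularPtAtInf (X : C2 → C2) (ψ : C2 → C2) (p : C2) : Prop :=
  ∃ (ρ : ℝ) (V : C2 → C2), 0 < ρ ∧ AnalyticOnNhd ℂ V (ball p ρ) ∧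
    (∀ w ∈ ball p ρ, V w ≠ 0) ∧
    ∀ w ∈ ball p ρ, w.1 ≠ 0 → det2 (fderiv ℂ ψ w (V w)) (X (ψ w)) = 0

/-! ### Blow-ups -/

/-- Elementary blow-up chart map centered at the point `(0, c)` (with `c = e.2`); in the
new coordinates the exceptional divisor is `{w | w.1 = 0}`.  The Boolean `e.1` selects
one of the two standard charts of the blow-up. -/
def elemMap (e : Bool × ℂ) (w : C2) : C2 :=
  if e.1 then (w.1, e.2 + w.1 * w.2) else (w.1 * w.2, e.2 + w.1)

/-- Chart map of an iterated blow-up; the head of the list is the first blow-up, and each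
subsequent blow-up is centered at a point `(0, c)` of the exceptional divisor of the
previous one. -/
def chainMap : List (Bool × ℂ) → C2 → C2
  | [] => id
  | e :: L => elemMap e ∘ chainMap L

/-- The two standard charts of the blow-up of the origin of ℂ²; in both, the exceptional
divisor `π⁻¹(0)` is `{w | w.1 = 0}`. -/
def sigma1 (w : C2) : C2 := (w.1, w.1 * w.2)
def sigma2 (w : C2) : C2 := (w.1 * w.2, w.1)

def trC (L : C2 →L[ℂ] C2) : ℂ := LinearMap.trace ℂ C2 L.toLinearMap
def detC (L : C2 →L[ℂ] C2) : ℂ := LinearMap.det L.toLinearMap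
def detfd (φ : C2 → C2) (w : C2) : ℂ := detC (fderiv ℂ φ w)

/-- A reduced local holomorphic generator, near the point `(0, t₀)` of the exceptional
divisor (in the first chart `sigma1`), of the blow-up of the foliation defined by `Z`:
a holomorphic vector field with isolated zeros tangent to the lifted foliation. -/
def ReducedGen1 (Z W : C2 → C2) (t₀ : ℂ) (r : ℝ) : Prop :=
  0 < r ∧ AnalyticOnNhd ℂ W (ball ((0 : ℂ), t₀) r) ∧
  (∀ w ∈ ball ((0 : ℂ), t₀) r, W w = 0 → ∀ᶠ w' in nhdsWithin w {w}ᶜ, W w' ≠ 0) ∧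
  (∀ w ∈ ball ((0 : ℂ), t₀) r, w.1 ≠ 0 →
    det2 (fderiv ℂ sigma1 w (W w)) (Z (sigma1 w)) = 0)

/-- As `ReducedGen1`, near the point of the exceptional divisor at infinity of the first
chart (i.e. the origin of the second chart `sigma2`). -/
def ReducedGen2 (Z W : C2 → C2) (r : ℝ) : Prop :=
  0 < r ∧ AnalyticOnNhd ℂ W (ball ((0 : ℂ), (0 : ℂ)) r) ∧
  (∀ w ∈ ball ((0 : ℂ), (0 : ℂ)) r, W w = 0 → ∀ᶠ w' in nhdsWithin w {w}ᶜ, W w' ≠ 0) ∧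
  (∀ w ∈ ball ((0 : ℂ), (0 : ℂ)) r, w.1 ≠ 0 →
    det2 (fderiv ℂ sigma2 w (W w)) (Z (sigma2 w)) = 0)

/-- Singular point of the blown-up foliation `F̃` on the exceptional divisor
`π⁻¹(0) ≅ ℙ¹` (realized as `OnePoint ℂ`). -/
def SingExc (Z : C2 → C2) (p : OnePoint ℂ) : Prop :=
  (p = OnePoint.infty ∧ ∃ W r, ReducedGen2 Z W r ∧ W (0, 0) = 0) ∨
  (∃ t₀ : ℂ, p = OnePoint.some t₀ ∧ ∃ W r, ReducedGen1 Z W t₀ r ∧ W (0, t₀) = 0)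

/-- The linear part of the blown-up foliation at the singular point `p` of the
exceptional divisor satisfies the property `Pc`. -/
def EigAtExc (Z : C2 → C2) (p : OnePoint ℂ) (Pc : (C2 →L[ℂ] C2) → Prop) : Prop :=
  (p = OnePoint.infty ∧ ∃ W r, ReducedGen2 Z W r ∧ W (0, 0) = 0 ∧
    Pc (fderiv ℂ W (0, 0))) ∨
  (∃ t₀ : ℂ, p = OnePoint.some t₀ ∧ ∃ W r, ReducedGen1 Z W t₀ r ∧ W (0, t₀) = 0 ∧
    Pc (fderiv ℂ W (0, t₀)))

/-- Eigenvalues `(1, 1)` (up to a common factor) with a nontrivial Jordan block: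
an LJ-singularity, i.e. the one given by the linear field `(x+y)∂/∂x + y∂/∂y`. -/
def isLJ (L : C2 →L[ℂ] C2) : Prop :=
  detC L ≠ 0 ∧ (trC L) ^ 2 = 4 * detC L ∧ ¬ ∀ v : C2, L v = (trC L / 2) • v

/-- Eigenvalue ratio `-1` (eigenvalues `-1, 1` up to a common factor). -/
def isRatioMinusOne (L : C2 →L[ℂ] C2) : Prop := trC L = 0 ∧ detC L ≠ 0

/-- Eigenvalue ratio `-1/2` (eigenvalues `-1, 2` up to a common factor). -/
def isRatioMinusHalf (L : C2 →L[ℂ] C2) : Prop :=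
  detC L ≠ 0 ∧ 2 * (trC L) ^ 2 + detC L = 0

/-- Saddle-node: exactly one nonzero eigenvalue (i.e. eigenvalues `1, 0` up to factor). -/
def isSN (L : C2 →L[ℂ] C2) : Prop := detC L = 0 ∧ trC L ≠ 0

/-- Saddle-node whose strong invariant manifold is contained in the exceptional divisor:
the direction `(0,1)` tangent to `{w.1 = 0}` is the eigendirection of the nonzero
eigenvalue. -/
def isSNalongExc (L : C2 →L[ℂ] C2) : Prop :=
  detC L = 0 ∧ trC L ≠ 0 ∧ L (0, 1) = trC L • (((0 : ℂ), (1 : ℂ)) : C2)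

/-- Both eigenvalues nonzero, with ratio `λ₁/λ₂ = -n/m`, `n, m ∈ ℕ*`. -/
def isNegRationalRatio (L : C2 →L[ℂ] C2) : Prop :=
  detC L ≠ 0 ∧ ∃ m n : ℕ, 0 < m ∧ 0 < n ∧
    (((m * n : ℕ) : ℂ)) * (trC L) ^ 2 + ((m : ℂ) - (n : ℂ)) ^ 2 * detC L = 0

/-- A simple singularity: at least one eigenvalue is nonzero. -/
def isSimpleLin (L : C2 →L[ℂ] C2) : Prop := trC L ≠ 0 ∨ detC L ≠ 0

/-- The blow-up of `Y` has order zero along the exceptional divisor: somewhere on the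
exceptional divisor the pulled-back vector field extends holomorphically without
vanishing identically (i.e. `π⁻¹(0)` is neither a zero nor a pole divisor of `Ỹ`). -/
def RegularOnExc (Y : C2 → C2) : Prop :=
  ∃ (t₀ : ℂ) (r : ℝ) (g : C2 → C2), 0 < r ∧
    AnalyticOnNhd ℂ g (ball ((0 : ℂ), t₀) r) ∧
    (∀ w ∈ ball ((0 : ℂ), t₀) r, w.1 ≠ 0 → fderiv ℂ sigma1 w (g w) = Y (sigma1 w)) ∧
    (∃ w ∈ ball ((0 : ℂ), t₀) r, w.1 = 0 ∧ g w ≠ 0)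

/-- `(0, c)` is a non-simple singular point (both eigenvalues zero) of the pullback of
the foliation of `Z` under the iterated blow-up chart `φ`. -/
def NonSimpleSingAt (Z : C2 → C2) (φ : C2 → C2) (p : C2) : Prop :=
  ∃ (W : C2 → C2) (r : ℝ), 0 < r ∧ AnalyticOnNhd ℂ W (ball p r) ∧
    (∀ w ∈ ball p r, W w = 0 → ∀ᶠ w' in nhdsWithin w {w}ᶜ, W w' ≠ 0) ∧
    (∀ w ∈ ball p r, detfd φ w ≠ 0 → det2 (fderiv ℂ φ w (W w)) (Z (φ w)) = 0) ∧
    W p = 0 ∧ trC (fderiv ℂ W p) = 0 ∧ detC (fderiv ℂ W p) = 0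

/-- A sequence of blow-ups as in Seidenberg's theorem: each blow-up is centered at a
point of the previous exceptional divisor which is a non-simple singularity of the
current transformed foliation. -/
def ValidFrom (Z : C2 → C2) : (C2 → C2) → List (Bool × ℂ) → Prop
  | _, [] => True
  | φ, e :: L => NonSimpleSingAt Z φ ((0 : ℂ), e.2) ∧ ValidFrom Z (φ ∘ elemMap e) L

/-- `X` has adapted poles at the point `(0, v₀)` (in the chart `ψ`) of the line at
infinity: for every finite sequence of blow-ups beginning at this point and every
irreducible component of the resulting exceptional divisor, either the pulled-back
vector field `X̃` vanishes identically on the component or the component consists of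
poles of `X̃` (equivalently: every local holomorphic extension of `X̃` over the
component vanishes identically on it). -/
def AdaptedAt (X : C2 → C2) (ψ : C2 → C2) (v₀ : ℂ) : Prop :=
  ∀ (L : List (Bool × ℂ)) (hL : L ≠ []), (L.head hL).2 = v₀ →
    ∀ (c : ℂ) (r : ℝ) (g : C2 → C2), 0 < r →
      AnalyticOnNhd ℂ g (ball ((0 : ℂ), c) r) →
      (∀ w ∈ ball ((0 : ℂ), c) r, detfd (fun w' => ψ (chainMap L w')) w ≠ 0 →
        fderiv ℂ (fun w' => ψ (chainMap L w')) w (g w) = X (ψ (chainMap L w))) →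
      ∀ w ∈ ball ((0 : ℂ), c) r, w.1 = 0 → g w = 0

/-- A rational first integral for the foliation defined by the polynomial vector field
`(P, Q)` (equivalently, by Serre's GAGA/Chow, a meromorphic first integral on ℂP²). -/
def HasRationalFirstIntegral (P Q : MvPolynomial (Fin 2) ℂ) : Prop :=
  ∃ A B : MvPolynomial (Fin 2) ℂ, B ≠ 0 ∧ (¬ ∃ c : ℂ, A = MvPolynomial.C c * B) ∧
    B * (P * MvPolynomial.pderiv 0 A + Q * MvPolynomial.pderiv 1 A)
      = A * (P * MvPolynomial.pderiv 0 B + Q * MvPolynomial.pderiv 1 B)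

/-- Assumption (2) of Section 4 and 5: every regular orbit of `Y` contains at most one
singular point of `Y`, whose order is one (formulated on embedded analytic discs inside
regular leaves of the foliation of `Z`, with `h` the restriction of `Y` expressed in the
disc coordinate). -/
def AtMostOneSimpleZeroPerOrbit (Y Z : C2 → C2) (U : Set C2) : Prop :=
  ∀ (r : ℝ) (γ : ℂ → C2) (h : ℂ → ℂ), 0 < r →
    AnalyticOnNhd ℂ γ (ball (0 : ℂ) r) → InjOn γ (ball (0 : ℂ) r) →
    (∀ t ∈ ball (0 : ℂ) r, γ t ∈ U ∧ Z (γ t) ≠ 0 ∧ deriv γ t ≠ 0) →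
    AnalyticOnNhd ℂ h (ball (0 : ℂ) r) →
    (∀ t ∈ ball (0 : ℂ) r, Y (γ t) = h t • deriv γ t) →
    ∀ t₁ ∈ ball (0 : ℂ) r, ∀ t₂ ∈ ball (0 : ℂ) r,
      h t₁ = 0 → h t₂ = 0 → t₁ = t₂ ∧ deriv h t₁ ≠ 0

/-- Assumption (3) of Section 4 and 5: the regular orbits of `Y` carry at most one
independent period: the time-form integrals of any two loops contained in the same
regular leaf are ℤ-linearly dependent. -/
def AtMostOnePeriod (Y Z : C2 → C2) (U : Set C2) : Prop :=
  ∀ (c₁ c₂ : ℝ → C2) (μ₁ μ₂ : ℝ → ℂ),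
    ContinuousOn μ₁ (Icc 0 1) → ContinuousOn μ₂ (Icc 0 1) →
    (∀ s ∈ Icc (0 : ℝ) 1, HasDerivAt c₁ (μ₁ s • Y (c₁ s)) s ∧ c₁ s ∈ U ∧
      Y (c₁ s) ≠ 0 ∧ Z (c₁ s) ≠ 0) →
    (∀ s ∈ Icc (0 : ℝ) 1, HasDerivAt c₂ (μ₂ s • Y (c₂ s)) s ∧ c₂ s ∈ U ∧
      Y (c₂ s) ≠ 0 ∧ Z (c₂ s) ≠ 0) →
    c₁ 0 = c₁ 1 → c₂ 0 = c₂ 1 →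
    (∃ (γ : ℝ → C2) (ν : ℝ → ℂ), ContinuousOn ν (Icc 0 1) ∧ γ 0 = c₁ 0 ∧ γ 1 = c₂ 0 ∧
      ∀ s ∈ Icc (0 : ℝ) 1, HasDerivAt γ (ν s • Z (γ s)) s ∧ γ s ∈ U ∧ Z (γ s) ≠ 0) →
    ∃ m n : ℤ, ¬(m = 0 ∧ n = 0) ∧
      (m : ℂ) * ∫ s in (0 : ℝ)..1, μ₁ s = (n : ℂ) * ∫ s in (0 : ℝ)..1, μ₂ s

/-- Trivial monodromy (first-return map along the fibers of `(x,y) ↦ y`) of the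
saddle-node foliation defined by `A(x,y) ∂/∂x + y^(p+1) ∂/∂y`. -/
def TrivialMonodromy (A : C2 → ℂ) (p : ℕ) : Prop :=
  ∃ ε > 0, ∀ y₀ : ℂ, y₀ ≠ 0 → ‖y₀‖ < ε → ∀ x : ℝ → ℂ,
    ContinuousOn x (Icc 0 1) → (∀ s ∈ Icc (0 : ℝ) 1, ‖x s‖ < ε) →
    (∀ s ∈ Icc (0 : ℝ) 1, HasDerivAt x
      ((2 * (Real.pi : ℂ) * Complex.I) *
        A (x s, y₀ * Complex.exp (2 * (Real.pi : ℂ) * Complex.I * (s : ℂ))) /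
        (y₀ * Complex.exp (2 * (Real.pi : ℂ) * Complex.I * (s : ℂ))) ^ p) s) →
    x 1 = x 0


/-! ### Helper lemmas -/

/-- Evaluation of the dehomogenization of the `k`-th homogeneous component. -/
def hcv (P : MvPolynomial (Fin 2) ℂ) (k : ℕ) (v : ℂ) : ℂ :=
  MvPolynomial.eval ![1, v] (MvPolynomial.homogeneousComponent k P)

lemma eval_homog (φ : MvPolynomial (Fin 2) ℂ) (n : ℕ) (h : φ.IsHomogeneous n) (c a b : ℂ) :
    MvPolynomial.eval ![c * a, c * b] φ = c ^ n * MvPolynomial.eval ![a, b] φ := by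
  rw [MvPolynomial.eval_eq', MvPolynomial.eval_eq', Finset.mul_sum]
  refine Finset.sum_congr rfl fun m hm => ?_
  have h1 : m.degree = n := by
    have := h (MvPolynomial.mem_support_iff.mp hm)
    rw [Finsupp.degree_eq_weight_one]
    exact this
  have h2 : m 0 + m 1 = n := by
    rw [← h1, Finsupp.degree_eq_sum, Fin.sum_univ_two]
  simp only [Fin.prod_univ_two, Matrix.cons_val_zero, Matrix.cons_val_one, mul_pow]
  rw [← h2, pow_add]
  ring

lemma eval_eq_sum (P : MvPolynomial (Fin 2) ℂ) (d : ℕ) (hd : P.totalDegree ≤ d) (x v : ℂ) :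
    MvPolynomial.eval ![x, x * v] P = ∑ k ∈ Finset.range (d + 1), x ^ k * hcv P k v := by
  have h : P = ∑ k ∈ Finset.range (d + 1), MvPolynomial.homogeneousComponent k P := by
    conv_lhs => rw [← MvPolynomial.sum_homogeneousComponent P]
    refine Finset.sum_subset (Finset.range_mono (by omega)) fun k _ hk => ?_
    apply MvPolynomial.homogeneousComponent_eq_zero
    simp at hk
    omega
  conv_lhs => rw [h]
  rw [map_sum]
  refine Finset.sum_congr rfl fun k _ => ?_
  have := eval_homog _ k (MvPolynomial.homogeneousComponent_isHomogeneous k P) x 1 v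
  rw [mul_one] at this
  exact this

lemma hcv_contDiff (P : MvPolynomial (Fin 2) ℂ) (k : ℕ) : ContDiff ℝ 1 (hcv P k) := by
  unfold hcv
  simp only [MvPolynomial.eval_eq', Fin.prod_univ_two, Matrix.cons_val_zero, Matrix.cons_val_one]
  fun_prop

/-- `u ^ d * P (1 / u, v / u)`. -/
def ptil (P : MvPolynomial (Fin 2) ℂ) (d : ℕ) (u v : ℂ) : ℂ :=
  ∑ k ∈ Finset.range (d + 1), u ^ (d - k) * hcv P k v

lemma ptil_eq (P : MvPolynomial (Fin 2) ℂ) (d : ℕ) (hd : P.totalDegree ≤ d) (u v : ℂ)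
    (hu : u ≠ 0) : ptil P d u v = u ^ d * pev P (1 / u, v / u) := by
  have h := eval_eq_sum P d hd (1 / u) v
  have h' : (1 / u) * v = v / u := by ring
  rw [h'] at h
  unfold pev ptil
  rw [h, Finset.mul_sum]
  refine Finset.sum_congr rfl fun k hk => ?_
  have hk : k ≤ d := by simp at hk; omega
  rw [← mul_assoc, pow_sub₀ _ hu hk]
  simp

/-- The second component of the desingularized field. -/
def htil (P Q : MvPolynomial (Fin 2) ℂ) (d : ℕ) (u v : ℂ) : ℂ :=
  ∑ k ∈ Finset.range d, u ^ (d - 1 - k) * (hcv Q k v - v * hcv P k v)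

lemma htil_eq (P Q : MvPolynomial (Fin 2) ℂ) (d : ℕ) (u v : ℂ)
    (h : hcv Q d v = v * hcv P d v) :
    u * htil P Q d u v = ptil Q d u v - v * ptil P d u v := by
  unfold htil ptil
  rw [Finset.sum_range_succ, Finset.sum_range_succ, h, mul_add, Finset.mul_sum, Finset.mul_sum]
  have : ∀ a b c e : ℂ, a + b - (c + e) = (a - c) + (b - e) := by intros; ring
  rw [this, ← Finset.sum_sub_distrib]
  simp only [Nat.sub_self, pow_zero, one_mul, sub_self, add_zero]
  refine Finset.sum_congr rfl fun k hk => ?_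
  have hk : k < d := by simpa using hk
  have : d - k = (d - 1 - k) + 1 := by omega
  rw [this, pow_succ]
  ring

lemma ptil_zero (P : MvPolynomial (Fin 2) ℂ) (d : ℕ) (v : ℂ) : ptil P d 0 v = hcv P d v := by
  unfold ptil
  rw [Finset.sum_range_succ, Finset.sum_eq_zero]
  · simp
  · intro k hk
    have hk : k < d := by simpa using hk
    rw [zero_pow (by omega), zero_mul]

lemma flow_kills (X : C2 → C2) (Φ : ℂ → C2 → C2)
    (hΦ : Differentiable ℂ fun q : ℂ × C2 => Φ q.1 q.2)
    (h0 : ∀ p, Φ 0 p = p)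
    (hadd : ∀ t s p, Φ (t + s) p = Φ t (Φ s p))
    (hder : ∀ p, HasDerivAt (fun T => Φ T p) (X p) 0) (t : ℂ) (p : C2) :
    fderiv ℂ (fun q : ℂ × C2 => Φ q.1 q.2) (t, p) ((-1 : ℂ), X p) = 0 := by
  have h1 : HasDerivAt (fun h : ℂ => (t - h, Φ h p)) ((-1 : ℂ), X p) 0 := by
    have := (hasDerivAt_id (0 : ℂ)).const_sub t
    exact this.prodMk (hder p)
  have h2 : HasFDerivAt (fun q : ℂ × C2 => Φ q.1 q.2)
      (fderiv ℂ (fun q : ℂ × C2 => Φ q.1 q.2) (t, p)) ((fun h : ℂ => (t - h, Φ h p)) 0) := by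
    simp only [sub_zero, h0]
    exact (hΦ (t, p)).hasFDerivAt
  have h3 := h2.comp_hasDerivAt (0 : ℂ) h1
  have h4 : ((fun q : ℂ × C2 => Φ q.1 q.2) ∘ fun h : ℂ => (t - h, Φ h p))
      = fun _ => Φ t p := by
    funext h
    simp only [Function.comp]
    rw [← hadd, sub_add_cancel]
  rw [h4] at h3
  exact h3.unique (hasDerivAt_const _ _)

lemma exists_transverse (P Q : MvPolynomial (Fin 2) ℂ)
    (d : ℕ) (hd : d = max P.totalDegree Q.totalDegree) (hd2 : 2 ≤ d)
    (hninv : MvPolynomial.X 0 * MvPolynomial.homogeneousComponent d Q =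
      MvPolynomial.X 1 * MvPolynomial.homogeneousComponent d P) :
    ∃ v, hcv P d v ≠ 0 := by
  have htop : ∀ R : MvPolynomial (Fin 2) ℂ, R.totalDegree = d →
      MvPolynomial.homogeneousComponent d R ≠ 0 := by
    intro R hR h
    have hR0 : R ≠ 0 := by
      rintro rfl
      simp at hR
      omega
    obtain ⟨m, hm, hm'⟩ := Finset.exists_mem_eq_sup R.support
      (MvPolynomial.support_nonempty.mpr hR0) (fun s => s.sum fun _ e => e)
    have hmd : m.degree = d := by
      rw [← hR]; exact hm'.symm
    have h5 := MvPolynomial.coeff_homogeneousComponent d R m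
    rw [h, if_pos hmd] at h5
    exact (MvPolynomial.mem_support_iff.mp hm) (by simpa using h5.symm)
  have hP : MvPolynomial.homogeneousComponent d P ≠ 0 := by
    intro h
    rw [h, mul_zero] at hninv
    have hQ : MvPolynomial.homogeneousComponent d Q = 0 :=
      (mul_eq_zero.mp hninv).resolve_left (MvPolynomial.X_ne_zero 0)
    rcases max_choice P.totalDegree Q.totalDegree with h' | h'
    · exact htop P (by omega) h
    · exact htop Q (by omega) hQ
  by_contra hcon
  push Not at hcon
  have : MvPolynomial.X 0 * MvPolynomial.homogeneousComponent d P = 0 := by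
    apply MvPolynomial.funext
    intro x
    rw [map_mul, MvPolynomial.eval_X, map_zero]
    by_cases hx : x 0 = 0
    · simp [hx]
    · have hxx : x = ![x 0 * 1, x 0 * (x 1 / x 0)] := by
        ext i
        fin_cases i
        · simp
        · simp; field_simp
      have h6 := eval_homog _ d (MvPolynomial.homogeneousComponent_isHomogeneous d P)
        (x 0) 1 (x 1 / x 0)
      rw [← hxx] at h6
      have h7 := hcon (x 1 / x 0)
      unfold hcv at h7
      rw [h6, h7]
      simp
  rcases mul_eq_zero.mp this with h | h
  · exact MvPolynomial.X_ne_zero 0 h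
  · exact hP h

lemma main_aux
    (P Q : MvPolynomial (Fin 2) ℂ) (X : C2 → C2)
    (hX : ∀ z, X z = (pev P z, pev Q z))
    (hcomp : IsCompleteVF X)
    (d : ℕ) (hd : d = max P.totalDegree Q.totalDegree) (hd2 : 2 ≤ d)
    (hninv : MvPolynomial.X 0 * MvPolynomial.homogeneousComponent d Q =
      MvPolynomial.X 1 * MvPolynomial.homogeneousComponent d P) : False := by
  obtain ⟨v₀, hv₀⟩ := exists_transverse P Q d hd hd2 hninv
  obtain ⟨Φ, hΦ, h0, hadd, hder⟩ := hcomp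
  have hPd : P.totalDegree ≤ d := by omega
  have hQd : Q.totalDegree ≤ d := by omega
  have hrel : ∀ v, hcv Q d v = v * hcv P d v := by
    intro v
    have := congrArg (MvPolynomial.eval ![1, v]) hninv
    simpa [hcv] using this
  let F : ℂ × ℂ × ℂ → ℂ × ℂ × ℂ := fun w =>
    (-ptil P d w.1 w.2.1, htil P Q d w.1 w.2.1, w.1 ^ (d - 2))
  have hF : ContDiff ℝ 1 F := by
    have hp := hcv_contDiff P
    have hq := hcv_contDiff Q
    simp only [F, ptil, htil]
    refine ContDiff.prodMk (ContDiff.neg (ContDiff.sum fun k _ => ?_))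
      (ContDiff.prodMk (ContDiff.sum fun k _ => ?_) (by fun_prop))
    · have := (hp k).comp (g := hcv P k) (f := fun w : ℂ × ℂ × ℂ => w.2.1) (by fun_prop)
      exact ContDiff.mul (by fun_prop) this
    · have h1 := (hp k).comp (g := hcv P k) (f := fun w : ℂ × ℂ × ℂ => w.2.1) (by fun_prop)
      have h2 := (hq k).comp (g := hcv Q k) (f := fun w : ℂ × ℂ × ℂ => w.2.1) (by fun_prop)
      exact ContDiff.mul (by fun_prop) (ContDiff.sub h2 (ContDiff.mul (by fun_prop) h1))
  obtain ⟨α, hα0, ε, hε, hα⟩ :=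
    (hF.contDiffAt (x := ((0 : ℂ), v₀, (0 : ℂ)))).exists_forall_mem_closedBall_exists_eq_forall_mem_Ioo_hasDerivAt₀ 0
  simp only [zero_sub, zero_add] at hα
  have hu : ∀ t ∈ Ioo (-ε) ε, HasDerivAt (fun s => (α s).1) (-ptil P d (α t).1 (α t).2.1) t :=
    fun t ht => (ContinuousLinearMap.fst ℝ ℂ (ℂ × ℂ)).hasFDerivAt.comp_hasDerivAt t (hα t ht)
  have hα2 : ∀ t ∈ Ioo (-ε) ε, HasDerivAt (fun s => (α s).2) (F (α t)).2 t :=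
    fun t ht => (ContinuousLinearMap.snd ℝ ℂ (ℂ × ℂ)).hasFDerivAt.comp_hasDerivAt t (hα t ht)
  have hv : ∀ t ∈ Ioo (-ε) ε,
      HasDerivAt (fun s => (α s).2.1) (htil P Q d (α t).1 (α t).2.1) t :=
    fun t ht => (ContinuousLinearMap.fst ℝ ℂ ℂ).hasFDerivAt.comp_hasDerivAt t (hα2 t ht)
  have hτ : ∀ t ∈ Ioo (-ε) ε, HasDerivAt (fun s => (α s).2.2) ((α t).1 ^ (d - 2)) t :=
    fun t ht => (ContinuousLinearMap.snd ℝ ℂ ℂ).hasFDerivAt.comp_hasDerivAt t (hα2 t ht)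
  have h0mem : (0 : ℝ) ∈ Ioo (-ε) ε := ⟨by linarith, hε⟩
  -- `u` does not vanish for small nonzero times
  have hne : ∀ᶠ s in nhdsWithin (0 : ℝ) {0}ᶜ, (α s).1 ≠ 0 := by
    have := (hu 0 h0mem).eventually_ne (c := 0) (by
      rw [hα0]; simpa [ptil_zero] using hv₀)
    exact this
  obtain ⟨δ, hδ, hδ'⟩ := Metric.mem_nhdsWithin_iff.mp hne
  set η := min δ ε with hη
  have hηpos : 0 < η := lt_min hδ hε
  have hune : ∀ s ∈ Ioo 0 η, (α s).1 ≠ 0 := by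
    intro s hs
    apply hδ'
    refine ⟨?_, ?_⟩
    · rw [Metric.mem_ball, dist_zero_right, Real.norm_eq_abs, abs_of_pos hs.1]
      exact lt_of_lt_of_le hs.2 (min_le_left _ _)
    · simpa using hs.1.ne'
  have hmem : ∀ s ∈ Ioo 0 η, s ∈ Ioo (-ε) ε := fun s hs =>
    ⟨by linarith [hs.1], lt_of_lt_of_le hs.2 (min_le_right _ _)⟩
  let c : ℝ → C2 := fun s => (1 / (α s).1, (α s).2.1 / (α s).1)
  have hc : ∀ s ∈ Ioo 0 η, HasDerivAt c ((α s).1 ^ (d - 2) • X (c s)) s := by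
    intro s hs
    have hus := hune s hs
    have hp : ∀ R : MvPolynomial (Fin 2) ℂ, R.totalDegree ≤ d →
        ptil R d (α s).1 (α s).2.1 = (α s).1 ^ 2 * ((α s).1 ^ (d - 2) * pev R (c s)) := by
      intro R hR
      rw [ptil_eq R d hR _ _ hus, ← mul_assoc, ← pow_add]
      congr 2
      omega
    have e1 : HasDerivAt (fun s => 1 / (α s).1) ((α s).1 ^ (d - 2) * pev P (c s)) s := by
      have := (hasDerivAt_const s (1 : ℂ)).fun_div (hu s (hmem s hs)) hus
      refine this.congr_deriv ?_
      rw [hp P hPd]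
      field_simp
      ring
    have e2 : HasDerivAt (fun s => (α s).2.1 / (α s).1) ((α s).1 ^ (d - 2) * pev Q (c s)) s := by
      have := (hv s (hmem s hs)).fun_div (hu s (hmem s hs)) hus
      refine this.congr_deriv ?_
      have h8 := htil_eq P Q d (α s).1 (α s).2.1 (hrel _)
      rw [div_eq_iff (pow_ne_zero 2 hus)]
      have h9 := hp Q hQd
      linear_combination h9 + h8
    rw [hX]
    exact e1.prodMk e2
  -- the flow brings `c` back to a fixed point
  let G : ℝ → C2 := fun s => Φ (-(α s).2.2) (c s)
  have hG : ∀ s ∈ Ioo 0 η, HasDerivAt G 0 s := by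
    intro s hs
    have hpair : HasDerivAt (fun s => (-(α s).2.2, c s))
        (-(α s).1 ^ (d - 2), (α s).1 ^ (d - 2) • X (c s)) s :=
      (hτ s (hmem s hs)).neg.prodMk (hc s hs)
    have hD := ((hΦ (-(α s).2.2, c s)).hasFDerivAt.restrictScalars ℝ)
    have h3 := hD.comp_hasDerivAt s hpair
    have hz : (-(α s).1 ^ (d - 2), (α s).1 ^ (d - 2) • X (c s))
        = (α s).1 ^ (d - 2) • ((-1 : ℂ), X (c s)) := by
      ext <;> simp
    have h4 : fderiv ℂ (fun q : ℂ × C2 => Φ q.1 q.2) (-(α s).2.2, c s)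
        (-(α s).1 ^ (d - 2), (α s).1 ^ (d - 2) • X (c s)) = 0 := by
      rw [hz, map_smul, flow_kills X Φ hΦ h0 hadd hder, smul_zero]
    have h5 : (ContinuousLinearMap.restrictScalars ℝ
        (fderiv ℂ (fun q : ℂ × C2 => Φ q.1 q.2) (-(α s).2.2, c s)))
        (-(α s).1 ^ (d - 2), (α s).1 ^ (d - 2) • X (c s)) = 0 := h4
    rw [h5] at h3
    exact h3
  obtain ⟨p₀, hp₀⟩ := isOpen_Ioo.exists_is_const_of_deriv_eq_zero (𝕜 := ℝ) (f := G)
    (s := Ioo 0 η) isPreconnected_Ioo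
    (fun s hs => (hG s hs).differentiableAt.differentiableWithinAt)
    (fun s hs => (hG s hs).deriv)
  have hcs : ∀ s ∈ Ioo 0 η, c s = Φ (α s).2.2 p₀ := by
    intro s hs
    rw [← hp₀ s hs]
    simp only [G]
    rw [← hadd, add_neg_cancel, h0]
  -- pass to the limit
  have hαc : ContinuousAt α 0 := (hα 0 h0mem).continuousAt
  have hK : ContinuousAt (fun s : ℝ => (α s).1 * (Φ (α s).2.2 p₀).1) 0 := by
    have hc1 : Continuous fun t : ℂ => Φ t p₀ :=
      hΦ.continuous.comp (g := fun q : ℂ × C2 => Φ q.1 q.2) (f := fun t : ℂ => (t, p₀))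
        (by fun_prop)
    have h1 : ContinuousAt (fun s : ℝ => Φ (α s).2.2 p₀) 0 :=
      hc1.continuousAt.comp (f := fun s : ℝ => (α s).2.2) hαc.snd.snd
    exact hαc.fst.mul h1.fst
  have hlim := hK.tendsto.mono_left (nhdsWithin_le_nhds (s := Ioi (0 : ℝ)))
  rw [hα0] at hlim
  simp only [zero_mul] at hlim
  have hev : ∀ᶠ s in nhdsWithin (0 : ℝ) (Ioi 0), (α s).1 * (Φ (α s).2.2 p₀).1 = 1 := by
    filter_upwards [Ioo_mem_nhdsGT hηpos] with s hs
    rw [← hcs s hs]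
    simp only [c]
    rw [mul_one_div, div_self (hune s hs)]
  have := tendsto_nhds_unique (hlim.congr' hev) tendsto_const_nhds
  exact zero_ne_one this

/-- If the line at infinity is not invariant by the foliation induced on ℂP² by a
complete polynomial vector field `X` (equivalently, the top-degree homogeneous component
of `X` is a multiple of the radial vector field, i.e. `x·Q_d − y·P_d ≡ 0`), then the
degree of `X` is at most 1. -/
theorem line_at_infinity_not_invariant_implies_degree_le_one
    (P Q : MvPolynomial (Fin 2) ℂ) (X : C2 → C2)
    (hX : ∀ z, X z = (pev P z, pev Q z))
    (hcomp : IsCompleteVF X)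
    (d : ℕ) (hd : d = max P.totalDegree Q.totalDegree)
    (hninv : MvPolynomial.X 0 * MvPolynomial.homogeneousComponent d Q =
      MvPolynomial.X 1 * MvPolynomial.homogeneousComponent d P) :
    max P.totalDegree Q.totalDegree ≤ 1 := by
  by_contra hcon
  exact main_aux P Q X hX hcomp d hd (by omega) hninv
end
end

section
/- Let X be a complete polynomial vector field on ℂ² of degree d, written as X = X₀ + X₁ + ⋯ + X_d where X_i is the homogeneous component of degree i. Then the top-degree homogeneous component X_d is semi-complete on the entire ℂ². -/
open Metric Set Filter Asymptotics

noncomputable section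

/-! ### Cauchy estimates -/

lemma cauchy_lip {E F : Type*} [NormedAddCommGroup E] [NormedSpace ℂ E]
    [NormedAddCommGroup F] [NormedSpace ℂ F] {G : E → F} {q : E} {r R : ℝ} (hr : 0 < r)
    (hG : DifferentiableOn ℂ G (ball q r)) (hR : ∀ x ∈ ball q r, ‖G x‖ ≤ R)
    {x y : E} (hx : x ∈ ball q (r / 4)) (hy : y ∈ ball q (r / 4)) :
    ‖G y - G x‖ ≤ 4 * R / r * ‖y - x‖ := by
  rw [mem_ball] at hx hy
  have hsub : ball x (r / 2) ⊆ ball q r := by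
    intro w hw
    rw [mem_ball] at hw ⊢
    linarith [dist_triangle w x q]
  have hyx : y ∈ ball x (r / 2) := by
    rw [mem_ball]
    linarith [dist_triangle_right y x q]
  have hxq : x ∈ ball q r := hsub (mem_ball_self (by positivity))
  have h := Complex.dist_le_div_mul_dist_of_mapsTo_ball (R₂ := 2 * R) (hG.mono hsub)
    (fun w hw => by
      rw [mem_closedBall, dist_eq_norm]
      linarith [norm_sub_le (G w) (G x), hR w (hsub hw), hR x hxq]) hyx
  rw [dist_eq_norm, dist_eq_norm] at h
  convert h using 2
  field_simp
  ring

lemma cauchy_fderiv {E F : Type*} [NormedAddCommGroup E] [NormedSpace ℂ E]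
    [NormedAddCommGroup F] [NormedSpace ℂ F] {G : E → F} {q : E} {r R : ℝ} (hr : 0 < r)
    (hG : Differentiable ℂ G) (hR : ∀ x ∈ ball q r, ‖G x‖ ≤ R)
    {x : E} (hx : x ∈ ball q (r / 32)) :
    ‖fderiv ℂ G x - fderiv ℂ G q‖ ≤ 128 * R / r ^ 2 * ‖x - q‖ := by
  have hR0 : 0 ≤ R := (norm_nonneg _).trans (hR q (mem_ball_self hr))
  have hd : HasFDerivAt (fun h => G (x + h) - G (q + h)) (fderiv ℂ G x - fderiv ℂ G q) 0 := by
    apply HasFDerivAt.sub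
    · have h0 : HasFDerivAt (fun h : E => x + h) (ContinuousLinearMap.id ℂ E) 0 :=
        (hasFDerivAt_id (0 : E)).const_add x
      have := HasFDerivAt.comp (0 : E) (hG (x + 0)).hasFDerivAt h0
      simpa [Function.comp_def] using this
    · have h0 : HasFDerivAt (fun h : E => q + h) (ContinuousLinearMap.id ℂ E) 0 :=
        (hasFDerivAt_id (0 : E)).const_add q
      have := HasFDerivAt.comp (0 : E) (hG (q + 0)).hasFDerivAt h0
      simpa [Function.comp_def] using this
  apply hd.le_of_lip' (by positivity)
  filter_upwards [ball_mem_nhds (0 : E) (show 0 < r / 8 by positivity)] with h hh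
  rw [mem_ball, dist_zero_right] at hh
  have key := cauchy_lip (G := fun z => G (z + h) - G z) (q := q) (r := r / 8)
    (R := 4 * R / r * ‖h‖) (by positivity) (by fun_prop) (by
      intro z hz
      rw [mem_ball] at hz
      have h1 : z ∈ ball q (r / 4) := by rw [mem_ball]; linarith
      have h2 : z + h ∈ ball q (r / 4) := by
        rw [mem_ball]
        have := dist_triangle (z + h) z q
        simp only [dist_self_add_left] at this
        linarith
      have := cauchy_lip hr hG.differentiableOn hR h1 h2
      simpa using this) (x := q) (y := x) (mem_ball_self (by positivity))
      (by rw [mem_ball] at hx ⊢; linarith)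
  simp only [add_zero, sub_zero]
  calc ‖G (x + h) - G (q + h) - (G x - G q)‖ = ‖G (x + h) - G x - (G (q + h) - G q)‖ := by
        congr 1; abel
    _ ≤ _ := key
    _ = _ := by field_simp; ring

lemma cauchy_strict {E F : Type*} [NormedAddCommGroup E] [NormedSpace ℂ E] 
    [NormedAddCommGroup F] [NormedSpace ℂ F] {G : E → F} {q : E} {r R : ℝ} (hr : 0 < r)
    (hG : Differentiable ℂ G) (hR : ∀ x ∈ ball q r, ‖G x‖ ≤ R) {ρ : ℝ} (hρ : ρ ≤ r / 32)
    {x y : E} (hx : x ∈ ball q ρ) (hy : y ∈ ball q ρ) :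
    ‖G y - G x - fderiv ℂ G q (y - x)‖ ≤ 128 * R / r ^ 2 * ρ * ‖y - x‖ := by
  have hR0 : 0 ≤ R := (norm_nonneg _).trans (hR q (mem_ball_self hr))
  let _ : NormedSpace ℝ E := NormedSpace.restrictScalars ℝ ℂ E
  refine Convex.norm_image_sub_le_of_norm_fderiv_le' (𝕜 := ℂ) (s := ball q ρ) (fun z _ => hG z)
    (fun z hz => ?_) (convex_ball q ρ) hx hy
  refine (cauchy_fderiv hr hG hR (ball_subset_ball hρ hz)).trans ?_
  rw [mem_ball, dist_eq_norm] at hz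
  gcongr

/-! ### Families of complete flows -/

/-- A family of complete fields `V l` (`l ≠ 0`) with flows `F l`, degenerating to the
homogeneous field `V 0`. -/
structure FlowFam (e : ℕ) (V : ℂ → C2 → C2) (F : ℂ → ℂ × C2 → C2) : Prop where
  contV : Continuous (fun q : ℂ × C2 => V q.1 q.2)
  lip : ∀ z, ∃ K, ∃ t ∈ nhds z, LipschitzOnWith K (V 0) t
  diff : ∀ l ≠ 0, Differentiable ℂ (F l)
  zero : ∀ l ≠ 0, ∀ p, F l (0, p) = p
  add : ∀ l ≠ 0, ∀ t s p, F l (t + s, p) = F l (t, F l (s, p))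
  ode : ∀ l ≠ 0, ∀ t p, HasDerivAt (fun T => F l (T, p)) (V l (F l (t, p))) t
  scal : ∀ l ≠ 0, ∀ c ≠ 0, ∀ t p, F l (t, c • p) = c • F (l / c) (c ^ e * t, p)
  hom : ∀ (c : ℂ) z, V 0 (c • z) = c ^ (e + 1) • V 0 z

/-- the punctured neighbourhood filter of `0`. -/
abbrev nz : Filter ℂ := nhdsWithin (0 : ℂ) {0}ᶜ

/-- The set of points near which the flows are bounded and convergent. -/
def fdom (F : ℂ → ℂ × C2 → C2) : Set (ℂ × C2) :=
  {q | ∃ r > 0, ∃ R : ℝ, (∀ᶠ l in nz, ∀ x ∈ ball q r, ‖F l x‖ ≤ R) ∧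
    ∀ x ∈ ball q r, ∃ y, Tendsto (fun l => F l x) nz (nhds y)}

/-- The limit flow. -/
def flim (F : ℂ → ℂ × C2 → C2) (q : ℂ × C2) : C2 := limUnder nz (fun l => F l q)

lemma fdom_of_nhds {F : ℂ → ℂ × C2 → C2} {q : ℂ × C2} {U : Set (ℂ × C2)} (hU : U ∈ nhds q)
    (R : ℝ) (hb : ∀ᶠ l in nz, ∀ x ∈ U, ‖F l x‖ ≤ R)
    (hc : ∀ x ∈ U, ∃ y, Tendsto (fun l => F l x) nz (nhds y)) : q ∈ fdom F := by
  obtain ⟨r, hr, hrU⟩ := Metric.mem_nhds_iff.1 hU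
  exact ⟨r, hr, R, hb.mono fun l hl x hx => hl x (hrU hx), fun x hx => hc x (hrU hx)⟩

lemma isOpen_fdom (F : ℂ → ℂ × C2 → C2) : IsOpen (fdom F) := by
  rw [isOpen_iff_mem_nhds]
  rintro q ⟨r, hr, R, hb, hc⟩
  filter_upwards [ball_mem_nhds q hr] with x hx
  exact fdom_of_nhds (isOpen_ball.mem_nhds hx) R hb hc

lemma tendsto_flim {F : ℂ → ℂ × C2 → C2} {q : ℂ × C2} (hq : q ∈ fdom F) :
    Tendsto (fun l => F l q) nz (nhds (flim F q)) := by
  obtain ⟨r, hr, R, hb, hc⟩ := hq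
  exact tendsto_nhds_limUnder (hc q (mem_ball_self hr))

lemma flim_eq {F : ℂ → ℂ × C2 → C2} {q : ℂ × C2} {y : C2}
    (h : Tendsto (fun l => F l q) nz (nhds y)) : flim F q = y := h.limUnder_eq

lemma ev_ne : ∀ᶠ l in nz, l ≠ (0 : ℂ) := eventually_mem_nhdsWithin

/-- equi-Lipschitz property near points of the domain -/
lemma FlowFam.equi {e : ℕ} {V : ℂ → C2 → C2} {F : ℂ → ℂ × C2 → C2} (H : FlowFam e V F)
    {q : ℂ × C2} (hq : q ∈ fdom F) : ∃ r > 0, ∃ C : ℝ, ∀ᶠ l in nz,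
      ∀ x ∈ ball q r, ∀ y ∈ ball q r, ‖F l y - F l x‖ ≤ C * ‖y - x‖ := by
  obtain ⟨r, hr, R, hb, hc⟩ := hq
  refine ⟨r / 4, by positivity, 4 * R / r, ?_⟩
  filter_upwards [hb, ev_ne] with l hl hl0 x hx y hy
  exact cauchy_lip hr (H.diff l hl0).differentiableOn hl hx hy

lemma FlowFam.tendsto_moving {e : ℕ} {V : ℂ → C2 → C2} {F : ℂ → ℂ × C2 → C2}
    (H : FlowFam e V F) {q : ℂ × C2} (hq : q ∈ fdom F) {g : ℂ → ℂ × C2}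
    (hg : Tendsto g nz (nhds q)) : Tendsto (fun l => F l (g l)) nz (nhds (flim F q)) := by
  obtain ⟨r, hr, C, hC⟩ := H.equi hq
  have h1 : Tendsto (fun l => F l (g l) - F l q) nz (nhds 0) := by
    apply squeeze_zero_norm' (a := fun l => C * ‖g l - q‖)
    · filter_upwards [hC, hg (ball_mem_nhds q hr)] with l hl hgl
      exact hl q (mem_ball_self hr) _ hgl
    · have : Tendsto (fun l => C * ‖g l - q‖) nz (nhds (C * ‖q - q‖)) :=
        ((hg.sub_const q).norm).const_mul C
      simpa using this
  simpa using h1.add (tendsto_flim hq)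

lemma FlowFam.comp {e : ℕ} {V : ℂ → C2 → C2} {F : ℂ → ℂ × C2 → C2} (H : FlowFam e V F)
    {a b : ℂ} {p : C2} (hb : (b, p) ∈ fdom F) (ha : (a, flim F (b, p)) ∈ fdom F) :
    (a + b, p) ∈ fdom F ∧ flim F (a + b, p) = flim F (a, flim F (b, p)) := by
  have hconv : ∀ {a b : ℂ} {p : C2}, (b, p) ∈ fdom F → (a, flim F (b, p)) ∈ fdom F →
      Tendsto (fun l => F l (a + b, p)) nz (nhds (flim F (a, flim F (b, p)))) := by
    intro a b p hb ha
    have := H.tendsto_moving ha (g := fun l => (a, F l (b, p)))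
      (tendsto_const_nhds.prodMk_nhds (tendsto_flim hb))
    refine this.congr' ?_
    filter_upwards [ev_ne] with l hl
    rw [H.add l hl]
  refine ⟨?_, flim_eq (hconv hb ha)⟩
  obtain ⟨r, hr, C, hC⟩ := H.equi hb
  obtain ⟨r', hr', R, hR, hc⟩ := id ha
  obtain ⟨r2, hr2, hsub2⟩ := Metric.isOpen_iff.1 (isOpen_fdom F) _ hb
  set m : C2 := flim F (b, p) with hm
  -- small neighbourhood
  obtain ⟨ρ, hρ, hρ1, hρ2, hρ3⟩ : ∃ ρ > 0, ρ ≤ r ∧ ρ ≤ r2 ∧ C * ρ < r' / 4 := by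
    have hC1 : 0 < |C| + 1 := by positivity
    refine ⟨min (min r r2) (r' / 8 / (|C| + 1)), by positivity,
      (min_le_left _ _).trans (min_le_left _ _), (min_le_left _ _).trans (min_le_right _ _), ?_⟩
    set ρ := min (min r r2) (r' / 8 / (|C| + 1))
    have h0 : 0 < ρ := by positivity
    have h1 : ρ ≤ r' / 8 / (|C| + 1) := min_le_right _ _
    rw [le_div_iff₀ hC1] at h1
    nlinarith [le_abs_self C]
  have hF : ∀ᶠ l in nz, ∀ p' ∈ ball p ρ, F l (b, p') ∈ ball m (r' / 2) := by
    filter_upwards [hC, (tendsto_flim hb) (ball_mem_nhds _ (show 0 < r' / 4 by positivity))] with l hl hl2 p' hp'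
    have h1 : (b, p') ∈ ball (b, p) ρ := by
      rw [mem_ball, Prod.dist_eq]; simp only [dist_self]; exact max_lt hρ hp'
    have h2 := hl (b, p) (mem_ball_self hr) (b, p') (ball_subset_ball hρ1 h1)
    have hl3 : dist (F l (b, p)) m < r' / 4 := hl2
    rw [mem_ball]
    rw [mem_ball, dist_eq_norm] at h1
    have hCC : 0 ≤ C ∨ C < 0 := le_or_gt 0 C
    have h3 : ‖F l (b, p') - F l (b, p)‖ < r' / 4 := by
      rcases hCC with h | h
      · nlinarith
      · nlinarith [norm_nonneg ((b, p') - (b, p))]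
    have := dist_triangle (F l (b, p')) (F l (b, p)) m
    rw [dist_eq_norm (F l (b, p')) (F l (b, p))] at this
    linarith
  have hU : ball (a + b) r' ×ˢ ball p ρ ∈ nhds (a + b, p) :=
    prod_mem_nhds (ball_mem_nhds _ hr') (ball_mem_nhds _ hρ)
  refine fdom_of_nhds (U := ball (a + b) r' ×ˢ ball p ρ) hU R ?_ ?_
  · filter_upwards [hF, hR, ev_ne] with l hl1 hl2 hl0 x hx
    obtain ⟨t, p'⟩ := x
    obtain ⟨ht, hp'⟩ := hx
    have : F l (t, p') = F l (t - b, F l (b, p')) := by rw [← H.add l hl0]; simp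
    rw [this]
    apply hl2
    rw [← ball_prod_same]
    refine ⟨?_, ball_subset_ball (by linarith) (hl1 p' hp')⟩
    simp only [mem_ball, dist_eq_norm] at ht ⊢
    rwa [sub_sub, add_comm b a]
  · rintro ⟨t, p'⟩ ⟨ht, hp'⟩
    have hbp : (b, p') ∈ fdom F := hsub2 (by
      rw [mem_ball, Prod.dist_eq]; simp only [dist_self]
      exact max_lt hr2 (lt_of_lt_of_le hp' hρ2))
    have hm' : flim F (b, p') ∈ closedBall m (r' / 2) := by
      refine isClosed_closedBall.mem_of_tendsto (tendsto_flim hbp) ?_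
      filter_upwards [hF] with l hl
      exact ball_subset_closedBall (hl p' hp')
    have hin : (t - b, flim F (b, p')) ∈ ball (a, m) r' := by
      rw [← ball_prod_same]
      refine ⟨?_, closedBall_subset_ball (by linarith) hm'⟩
      simp only [mem_ball, dist_eq_norm] at ht ⊢
      rwa [sub_sub, add_comm b a]
    have h2 : (t - b, flim F (b, p')) ∈ fdom F :=
      fdom_of_nhds (isOpen_ball.mem_nhds hin) R hR hc
    have := hconv hbp h2
    rw [sub_add_cancel] at this
    exact ⟨_, this⟩

lemma FlowFam.strict {e : ℕ} {V : ℂ → C2 → C2} {F : ℂ → ℂ × C2 → C2} (H : FlowFam e V F)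
    {q : ℂ × C2} (hq : q ∈ fdom F) : ∃ L : ℂ × C2 →L[ℂ] C2,
      HasStrictFDerivAt (flim F) L q ∧ L (1, 0) = V 0 (flim F q) := by
  obtain ⟨r0, hr0, hsub⟩ := Metric.isOpen_iff.1 (isOpen_fdom F) _ hq
  obtain ⟨r, hr, R, hb, hc⟩ := id hq
  have hR0 : 0 ≤ R := by
    obtain ⟨l, hl⟩ := hb.exists
    exact (norm_nonneg _).trans (hl q (mem_ball_self hr))
  -- derivative bound
  have hbd : ∀ᶠ l in nz, fderiv ℂ (F l) q ∈ closedBall (0 : ℂ × C2 →L[ℂ] C2) (4 * R / r) := by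
    filter_upwards [hb, ev_ne] with l hl hl0
    rw [mem_closedBall, dist_zero_right]
    apply ((H.diff l hl0) q).hasFDerivAt.le_of_lip' (by positivity)
    filter_upwards [ball_mem_nhds q (show 0 < r / 4 by positivity)] with x hx
    exact cauchy_lip hr (H.diff l hl0).differentiableOn hl (mem_ball_self (by positivity)) hx
  let U : Ultrafilter ℂ := Ultrafilter.of nz
  have hU : (U : Filter ℂ) ≤ nz := Ultrafilter.of_le nz
  have : ProperSpace (ℂ × C2 →L[ℂ] C2) := FiniteDimensional.proper ℂ _
  obtain ⟨L, -, hL⟩ := (isCompact_closedBall (0 : ℂ × C2 →L[ℂ] C2) (4 * R / r)).ultrafilter_le_nhds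
    (U.map (fun l => fderiv ℂ (F l) q)) (by
      rw [le_principal_iff]
      exact hU hbd)
  have hL' : Tendsto (fun l => fderiv ℂ (F l) q) U (nhds L) := hL
  refine ⟨L, ?_, ?_⟩
  · rw [hasStrictFDerivAt_iff_isLittleO, isLittleO_iff]
    intro c hc0
    obtain ⟨ρ, hρ, hρ1, hρ2, hρ3⟩ : ∃ ρ > 0, ρ ≤ r / 32 ∧ ρ ≤ r0 ∧
        128 * R / r ^ 2 * ρ ≤ c := by
      set A := 128 * R / r ^ 2
      have hA : 0 ≤ A := by positivity
      refine ⟨min (min (r / 32) r0) (c / (A + 1)), by positivity,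
        (min_le_left _ _).trans (min_le_left _ _), (min_le_left _ _).trans (min_le_right _ _), ?_⟩
      set ρ := min (min (r / 32) r0) (c / (A + 1))
      have h0 : 0 < ρ := by positivity
      have h1 : ρ ≤ c / (A + 1) := min_le_right _ _
      rw [le_div_iff₀ (by positivity)] at h1
      nlinarith
    filter_upwards [prod_mem_nhds (ball_mem_nhds q hρ) (ball_mem_nhds q hρ)] with z hz
    obtain ⟨hz1, hz2⟩ := hz
    have t1 := (tendsto_flim (hsub (ball_subset_ball hρ2 hz1))).mono_left hU
    have t2 := (tendsto_flim (hsub (ball_subset_ball hρ2 hz2))).mono_left hU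
    have t3 : Tendsto (fun l => fderiv ℂ (F l) q (z.1 - z.2)) U (nhds (L (z.1 - z.2))) :=
      ((ContinuousLinearMap.apply ℂ C2 (z.1 - z.2)).continuous.tendsto L).comp hL'
    refine le_of_tendsto ((t1.sub t2).sub t3).norm ?_
    filter_upwards [hU hb, hU ev_ne] with l hl hl0
    refine (cauchy_strict hr (H.diff l hl0) hl hρ1 hz2 hz1).trans ?_
    gcongr
  · have t3 : Tendsto (fun l => fderiv ℂ (F l) q (1, 0)) U (nhds (L (1, 0))) :=
      ((ContinuousLinearMap.apply ℂ C2 ((1 : ℂ), (0 : C2))).continuous.tendsto L).comp hL'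
    have t4 : Tendsto (fun l => V l (F l q)) U (nhds (V 0 (flim F q))) := by
      have h1 : Tendsto (fun l : ℂ => l) U (nhds 0) := hU.trans nhdsWithin_le_nhds
      exact (H.contV.tendsto (0, flim F q)).comp
        (h1.prodMk_nhds ((tendsto_flim hq).mono_left hU))
    refine tendsto_nhds_unique t3 (t4.congr' ?_)
    filter_upwards [hU ev_ne] with l hl0
    have h1 : HasDerivAt (fun T : ℂ => (T, q.2)) ((1 : ℂ), (0 : C2)) q.1 :=
      (hasDerivAt_id q.1).prodMk (hasDerivAt_const q.1 q.2)
    have h2 := ((H.diff l hl0) q).hasFDerivAt.comp_hasDerivAt q.1 h1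
    exact (H.ode l hl0 q.1 q.2).unique h2

lemma FlowFam.hasDeriv {e : ℕ} {V : ℂ → C2 → C2} {F : ℂ → ℂ × C2 → C2} (H : FlowFam e V F)
    {t : ℂ} {p : C2} (hq : (t, p) ∈ fdom F) :
    HasDerivAt (fun T => flim F (T, p)) (V 0 (flim F (t, p))) t := by
  obtain ⟨L, hL, hL1⟩ := H.strict hq
  rw [← hL1]
  have h1 : HasDerivAt (fun T : ℂ => (T, p)) ((1 : ℂ), (0 : C2)) t :=
    (hasDerivAt_id t).prodMk (hasDerivAt_const t p)
  exact hL.hasFDerivAt.comp_hasDerivAt t h1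

lemma FlowFam.cont {e : ℕ} {V : ℂ → C2 → C2} {F : ℂ → ℂ × C2 → C2} (H : FlowFam e V F)
    {q : ℂ × C2} (hq : q ∈ fdom F) : ContinuousAt (flim F) q := by
  obtain ⟨L, hL, hL1⟩ := H.strict hq
  exact hL.continuousAt

lemma FlowFam.flim_zero {e : ℕ} {V : ℂ → C2 → C2} {F : ℂ → ℂ × C2 → C2} (H : FlowFam e V F)
    (p : C2) : flim F (0, p) = p := by
  apply flim_eq
  refine tendsto_const_nhds.congr' ?_
  filter_upwards [ev_ne] with l hl
  rw [H.zero l hl]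

lemma FlowFam.scaling {e : ℕ} {V : ℂ → C2 → C2} {F : ℂ → ℂ × C2 → C2} (H : FlowFam e V F)
    {t c : ℂ} (hc0 : c ≠ 0) {p : C2} (hq : (t, c • p) ∈ fdom F) :
    (c ^ e * t, p) ∈ fdom F ∧ flim F (c ^ e * t, p) = c⁻¹ • flim F (t, c • p) := by
  have hl : Tendsto (fun l : ℂ => l * c) nz nz := by
    refine tendsto_nhdsWithin_iff.2 ⟨?_, ?_⟩
    · have : Tendsto (fun l : ℂ => l * c) (nhds 0) (nhds (0 * c)) :=
        (continuous_id.mul continuous_const).tendsto 0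
      rw [zero_mul] at this
      exact this.mono_left nhdsWithin_le_nhds
    · filter_upwards [ev_ne] with l hl
      exact mul_ne_zero hl hc0
  have hF : ∀ l ≠ 0, ∀ (s : ℂ) (p' : C2),
      F l (s, p') = c⁻¹ • F (l * c) ((c ^ e)⁻¹ * s, c • p') := by
    intro l hl s p'
    rw [H.scal (l * c) (mul_ne_zero hl hc0) c hc0, smul_smul, inv_mul_cancel₀ hc0, one_smul,
      mul_div_cancel_right₀ _ hc0, mul_inv_cancel_left₀ (pow_ne_zero e hc0)]
  let m : ℂ × C2 → ℂ × C2 := fun x => ((c ^ e)⁻¹ * x.1, c • x.2)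
  have hm : Continuous m := by fun_prop
  have hm0 : m (c ^ e * t, p) = (t, c • p) := by
    simp [m, inv_mul_cancel_left₀ (pow_ne_zero e hc0)]
  have hconv : ∀ x y, Tendsto (fun l => F l (m x)) nz (nhds y) →
      Tendsto (fun l => F l x) nz (nhds (c⁻¹ • y)) := by
    intro x y h
    refine ((h.comp hl).const_smul c⁻¹).congr' ?_
    filter_upwards [ev_ne] with l hl0
    rw [← Prod.mk.eta (p := x), hF l hl0]
    rfl
  constructor
  · obtain ⟨r, hr, R, hb, hc⟩ := hq
    refine fdom_of_nhds (U := m ⁻¹' ball (t, c • p) r)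
      (hm.continuousAt.preimage_mem_nhds (by rw [hm0]; exact ball_mem_nhds _ hr))
      (‖c⁻¹‖ * R) ?_ ?_
    · filter_upwards [hl.eventually hb, ev_ne] with l hl1 hl0 x hx
      rw [← Prod.mk.eta (p := x), hF l hl0, norm_smul]
      gcongr
      exact hl1 _ hx
    · intro x hx
      obtain ⟨y, hy⟩ := hc _ hx
      exact ⟨_, hconv x y hy⟩
  · apply flim_eq
    apply hconv
    rw [hm0]
    exact tendsto_flim hq

lemma FlowFam.odeR {e : ℕ} {V : ℂ → C2 → C2} {F : ℂ → ℂ × C2 → C2} (H : FlowFam e V F)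
    {l : ℂ} (hl : l ≠ 0) (t : ℂ) (p : C2) (u : ℝ) :
    HasDerivAt (fun u : ℝ => F l ((u : ℂ) * t, p)) (t • V l (F l (u * t, p))) u := by
  have h1 : HasDerivAt (fun u : ℝ => (u : ℂ) * t) t u := by
    simpa using (Complex.ofRealCLM.hasDerivAt (x := u)).mul_const t
  exact HasDerivAt.scomp (g₁ := fun T : ℂ => F l (T, p)) u (H.ode l hl (u * t) p) h1

/-- Uniform local existence and convergence. -/
lemma FlowFam.box {e : ℕ} {V : ℂ → C2 → C2} {F : ℂ → ℂ × C2 → C2} (H : FlowFam e V F)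
    (k : C2) : ((0 : ℂ), k) ∈ fdom F := by
  obtain ⟨K, S, hS, hlip⟩ := H.lip k
  obtain ⟨ρ, hρ, hρS⟩ := Metric.nhds_basis_closedBall.mem_iff.1 hS
  have hcpt : IsCompact (closedBall (0 : ℂ) 1 ×ˢ closedBall k ρ) :=
    (isCompact_closedBall _ _).prod (isCompact_closedBall _ _)
  obtain ⟨M, hM⟩ := hcpt.exists_bound_of_continuousOn H.contV.continuousOn
  have hM0 : 0 ≤ M := (norm_nonneg _).trans (hM (0, k) ⟨by simp, by simp [hρ.le]⟩)
  -- uniform convergence of `V l` to `V 0`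
  have hunif : ∀ ε > 0, ∀ᶠ l in nz, ∀ z ∈ closedBall k ρ, ‖V l z - V 0 z‖ ≤ ε := by
    intro ε hε
    have h1 := (hcpt.uniformContinuousOn_of_continuous H.contV.continuousOn)
    rw [Metric.uniformContinuousOn_iff] at h1
    obtain ⟨δ, hδ, h2⟩ := h1 ε hε
    have h3 : ball (0 : ℂ) (min δ 1) ∈ nz := nhdsWithin_le_nhds (ball_mem_nhds _ (by positivity))
    filter_upwards [h3] with l hl z hz
    rw [mem_ball] at hl
    have := h2 (l, z) ⟨(hl.trans_le (min_le_right _ _)).le, hz⟩ (0, z) ⟨by simp, hz⟩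
      (by rw [Prod.dist_eq]; simp only [dist_self]
          exact max_lt (hl.trans_le (min_le_left _ _)) hδ)
    rw [dist_eq_norm] at this
    exact this.le
  set δ : ℝ := min (ρ / 2) (ρ / 2 / (M + 1)) with hδdef
  have hδ : 0 < δ := by positivity
  have hδM : δ * M < ρ / 2 := by
    have h1 : δ ≤ ρ / 2 / (M + 1) := min_le_right _ _
    rw [le_div_iff₀ (by positivity)] at h1
    nlinarith
  have hstay : ∀ l : ℂ, l ≠ 0 → ‖l‖ ≤ 1 → ∀ t ∈ ball (0 : ℂ) δ, ∀ p ∈ ball k δ,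
      ∀ u ∈ Icc (0 : ℝ) 1, F l ((u : ℂ) * t, p) ∈ closedBall k ρ := by
    intro l hl0 hl1 t ht p hp u hu
    have hder := H.odeR hl0 t p
    have := image_norm_le_of_norm_deriv_right_lt_deriv_boundary
      (f := fun u : ℝ => F l ((u : ℂ) * t, p) - k) (a := 0) (b := 1)
      (f' := fun u => t • V l (F l (u * t, p)))
      (fun x _ => ((hder x).sub_const k).continuousAt.continuousWithinAt)
      (fun x _ => ((hder x).sub_const k).hasDerivWithinAt)
      (B := fun u => ρ / 2 + u * (ρ / 2)) (B' := fun _ => ρ / 2)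
      (by
        simp only [Complex.ofReal_zero, zero_mul, H.zero l hl0, add_zero]
        rw [mem_ball, dist_eq_norm] at hp
        exact hp.le.trans (min_le_left _ _))
      (fun x => by simpa using ((hasDerivAt_id x).mul_const (ρ / 2)).const_add (ρ / 2))
      (by
        intro x hx heq
        have hle : ‖F l ((x : ℂ) * t, p) - k‖ ≤ ρ := by
          rw [heq]; nlinarith [hx.2]
        have h1 := hM (l, F l ((x : ℂ) * t, p))
          ⟨by simpa using hl1, by rw [mem_closedBall, dist_eq_norm]; exact hle⟩
        rw [norm_smul]
        rw [mem_ball, dist_zero_right] at ht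
        calc ‖t‖ * ‖V l (F l (x * t, p))‖ ≤ δ * M := by gcongr
          _ < ρ / 2 := hδM) hu
    rw [mem_closedBall, dist_eq_norm]
    refine this.trans ?_
    nlinarith [hu.2]
  have hl1 : ∀ᶠ l in nz, ‖l‖ ≤ (1 : ℝ) := by
    have h3 : ball (0 : ℂ) 1 ∈ nz := nhdsWithin_le_nhds (ball_mem_nhds _ one_pos)
    filter_upwards [h3] with l hl
    rw [mem_ball, dist_zero_right] at hl
    exact hl.le
  refine fdom_of_nhds (U := ball (0 : ℂ) δ ×ˢ ball k δ)
    (prod_mem_nhds (ball_mem_nhds _ hδ) (ball_mem_nhds _ hδ)) (‖k‖ + ρ) ?_ ?_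
  · filter_upwards [hl1, ev_ne] with l hl hl0 x hx
    have := hstay l hl0 hl x.1 hx.1 x.2 hx.2 1 (by simp)
    simp only [Complex.ofReal_one, one_mul, mem_closedBall, dist_eq_norm] at this
    have h2 := norm_sub_norm_le (F l x) k
    linarith
  · rintro ⟨t, p⟩ ⟨ht, hp⟩
    refine cauchy_map_iff_exists_tendsto.1 ?_
    rw [Metric.cauchy_iff]
    refine ⟨inferInstance, fun ε hε => ?_⟩
    have hg : Tendsto (fun η : ℝ => gronwallBound 0 (‖t‖₊ * K : NNReal) (η + η) (1 - 0))
        (nhds 0) (nhds 0) := by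
      have h1 : Continuous (fun η : ℝ => gronwallBound 0 (‖t‖₊ * K : NNReal) (η + η) (1 - 0)) :=
        (gronwallBound_continuous_ε 0 _ (1 - 0)).comp (by fun_prop)
      have := h1.tendsto 0
      simpa [gronwallBound_ε0] using this
    obtain ⟨η, hη1, hη2⟩ : ∃ η > 0, gronwallBound 0 (‖t‖₊ * K : NNReal) (η + η) (1 - 0) < ε := by
      have h1 := hg.eventually (gt_mem_nhds hε)
      have h2 : ∀ᶠ η : ℝ in nhdsWithin 0 (Ioi 0), η > 0 ∧
          gronwallBound 0 (‖t‖₊ * K : NNReal) (η + η) (1 - 0) < ε :=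
        (eventually_mem_nhdsWithin).and (h1.filter_mono nhdsWithin_le_nhds)
      exact h2.exists
    have hη3 : 0 < η / (‖t‖ + 1) := by positivity
    have hA := (hunif _ hη3).and (hl1.and ev_ne)
    refine ⟨_, image_mem_map hA, ?_⟩
    rintro _ ⟨l, ⟨hl, hl1, hl0⟩, rfl⟩ _ ⟨l', ⟨hl', hl1', hl0'⟩, rfl⟩
    have happ : ∀ l : ℂ, (∀ z ∈ closedBall k ρ, ‖V l z - V 0 z‖ ≤ η / (‖t‖ + 1)) → ‖l‖ ≤ 1 →
        l ≠ 0 → ∀ u ∈ Ico (0 : ℝ) 1,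
        dist (t • V l (F l (u * t, p))) (t • V 0 (F l (u * t, p))) ≤ η := by
      intro l hl hl1 hl0 u hu
      rw [dist_eq_norm, ← smul_sub, norm_smul]
      have h1 := hl _ (hstay l hl0 hl1 t ht p hp u ⟨hu.1, hu.2.le⟩)
      calc _ ≤ ‖t‖ * (η / (‖t‖ + 1)) := by gcongr
        _ ≤ η := by
          rw [mul_div_assoc', div_le_iff₀ (by positivity)]
          nlinarith [norm_nonneg t]
    have := dist_le_of_approx_trajectories_ODE_of_mem (v := fun _ z => t • V 0 z)
      (s := fun _ => closedBall k ρ) (K := ‖t‖₊ * K)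
      (f := fun u : ℝ => F l ((u : ℂ) * t, p)) (g := fun u : ℝ => F l' ((u : ℂ) * t, p))
      (f' := fun u : ℝ => t • V l (F l (u * t, p))) (g' := fun u : ℝ => t • V l' (F l' (u * t, p)))
      (a := 0) (b := 1) (εf := η) (εg := η) (δ := 0)
      (fun _ _ => by
        have h1 : LipschitzWith ‖t‖₊ (fun z : C2 => t • z) := lipschitzWith_smul t
        exact h1.comp_lipschitzOnWith (hlip.mono hρS))
      (fun x _ => (H.odeR hl0 t p x).continuousAt.continuousWithinAt)
      (fun x _ => (H.odeR hl0 t p x).hasDerivWithinAt)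
      (happ l hl hl1 hl0)
      (fun x hx => hstay l hl0 hl1 t ht p hp x ⟨hx.1, hx.2.le⟩)
      (fun x _ => (H.odeR hl0' t p x).continuousAt.continuousWithinAt)
      (fun x _ => (H.odeR hl0' t p x).hasDerivWithinAt)
      (happ l' hl' hl1' hl0')
      (fun x hx => hstay l' hl0' hl1' t ht p hp x ⟨hx.1, hx.2.le⟩)
      (by simp [H.zero l hl0, H.zero l' hl0']) 1 (by simp)
    simp only [Complex.ofReal_one, one_mul] at this
    exact this.trans_lt hη2

lemma FlowFam.boxball {e : ℕ} {V : ℂ → C2 → C2} {F : ℂ → ℂ × C2 → C2} (H : FlowFam e V F)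
    (k : C2) {ε : ℝ} (hε : 0 < ε) : ∃ δ > 0, ∀ t : ℂ, ‖t‖ < δ → ∀ p ∈ ball k δ,
      (t, p) ∈ fdom F ∧ dist (flim F (t, p)) k < ε := by
  have h1 : ∀ᶠ q in nhds ((0 : ℂ), k), q ∈ fdom F := (isOpen_fdom F).mem_nhds (H.box k)
  have h2 : ∀ᶠ q in nhds ((0 : ℂ), k), dist (flim F q) k < ε := by
    have := (H.cont (H.box k)).eventually (ball_mem_nhds _ hε)
    rw [H.flim_zero] at this
    exact this
  obtain ⟨δ, hδ, h⟩ := Metric.eventually_nhds_iff_ball.1 (h1.and h2)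
  refine ⟨δ, hδ, fun t ht p hp => h (t, p) ?_⟩
  rw [← ball_prod_same]
  exact ⟨by simpa using ht, hp⟩

/-- An explicit solution along a segment forces the segment to be in the domain. -/
lemma FlowFam.segment {e : ℕ} {V : ℂ → C2 → C2} {F : ℂ → ℂ × C2 → C2} (H : FlowFam e V F)
    {T : ℂ} {p : C2} {z : ℝ → C2} (hz0 : z 0 = p)
    (hz : ∀ u ∈ Icc (0 : ℝ) 1, ∀ᶠ v in nhds u, HasDerivAt z (T • V 0 (z v)) v) :
    (T, p) ∈ fdom F := by
  let A : Set ℝ := {u | ((u : ℂ) * T, p) ∈ fdom F ∧ flim F ((u : ℂ) * T, p) = z u}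
  have hcts : Continuous (fun u : ℝ => (((u : ℂ) * T, p) : ℂ × C2)) := by fun_prop
  have hzc : ∀ u ∈ Icc (0 : ℝ) 1, ContinuousAt z u := fun u hu =>
    (hz u hu).self_of_nhds.continuousAt
  have hsub : Icc (0 : ℝ) 1 ⊆ A := by
    apply IsClosed.Icc_subset_of_forall_exists_gt
    · rw [← isSeqClosed_iff_isClosed]
      intro x u hx hxu
      have hu : u ∈ Icc (0 : ℝ) 1 := isClosed_Icc.mem_of_tendsto hxu
        (Eventually.of_forall fun n => (hx n).2)
      have hzx : Tendsto (fun n => z (x n)) atTop (nhds (z u)) := (hzc u hu).tendsto.comp hxu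
      obtain ⟨δ, hδ, hbox⟩ := H.boxball (z u) one_pos
      have h1 : Tendsto (fun n => ((u : ℂ) - (x n : ℂ)) * T) atTop (nhds 0) := by
        have : Tendsto (fun n => ((u : ℂ) - (x n : ℂ)) * T) atTop
            (nhds (((u : ℂ) - (u : ℂ)) * T)) :=
          (tendsto_const_nhds.sub ((Complex.continuous_ofReal.tendsto u).comp hxu)).mul_const T
        simpa using this
      obtain ⟨n, hn1, hn2⟩ :=
        ((h1.eventually (ball_mem_nhds _ hδ)).and (hzx.eventually (ball_mem_nhds _ hδ))).exists
      have hn3 := (hx n).1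
      have h2 : (((u : ℂ) - (x n : ℂ)) * T, flim F ((x n : ℂ) * T, p)) ∈ fdom F := by
        rw [hn3.2]
        exact (hbox _ (by simpa using hn1) _ hn2).1
      have h3 := (H.comp hn3.1 h2).1
      rw [← add_mul, sub_add_cancel] at h3
      refine ⟨⟨h3, ?_⟩, hu⟩
      have h4 : Tendsto (fun n => flim F ((x n : ℂ) * T, p)) atTop
          (nhds (flim F ((u : ℂ) * T, p))) :=
        (H.cont h3).tendsto.comp ((hcts.tendsto u).comp hxu)
      refine tendsto_nhds_unique h4 (hzx.congr fun n => ?_)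
      exact (hx n).1.2.symm
    · refine ⟨?_, ?_⟩
      · simpa using H.box p
      · simpa [hz0] using H.flim_zero p
    · rintro u ⟨⟨hu1, hu2⟩, hu3⟩ y hy
      have huI : u ∈ Icc (0 : ℝ) 1 := ⟨hu3.1, hu3.2.le⟩
      have hev : ∀ᶠ v : ℝ in nhds u, ((v : ℂ) * T, p) ∈ fdom F :=
        hcts.continuousAt.eventually ((isOpen_fdom F).mem_nhds hu1)
      obtain ⟨K, S, hS, hlip⟩ := H.lip (z u)
      have heq : (fun v : ℝ => flim F ((v : ℂ) * T, p)) =ᶠ[nhds u] z := by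
        refine ODE_solution_unique_of_eventually (v := fun _ z => T • V 0 z) (s := fun _ => S)
          (K := ‖T‖₊ * K) ?_ ?_ ?_ hu2
        · refine Eventually.of_forall fun _ => ?_
          have h1 : LipschitzWith ‖T‖₊ (fun z : C2 => T • z) := lipschitzWith_smul T
          exact h1.comp_lipschitzOnWith hlip
        · have hc : ContinuousAt (fun v : ℝ => flim F ((v : ℂ) * T, p)) u :=
            ContinuousAt.comp (f := fun u : ℝ => (((u : ℂ) * T, p) : ℂ × C2)) (H.cont hu1)
              hcts.continuousAt
          have hS2 : S ∈ nhds (flim F ((u : ℂ) * T, p)) := by rw [hu2]; exact hS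
          have hS' : ∀ᶠ v : ℝ in nhds u, flim F ((v : ℂ) * T, p) ∈ S :=
            hc.eventually hS2
          filter_upwards [hev, hS'] with v hv hvS
          refine ⟨?_, hvS⟩
          have h1 : HasDerivAt (fun u : ℝ => (u : ℂ) * T) T v := by
            simpa using (Complex.ofRealCLM.hasDerivAt (x := v)).mul_const T
          exact HasDerivAt.scomp (g₁ := fun t : ℂ => flim F (t, p)) v (H.hasDeriv hv) h1
        · filter_upwards [hz u huI, (hzc u huI).eventually hS] with v hv hvS
          exact ⟨hv, hvS⟩
      have hboth := hev.and heq
      have hI : Ioc u y ∈ nhdsWithin u (Ioi u) := Ioc_mem_nhdsGT hy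
      obtain ⟨v, hv1, hv2⟩ := ((hboth.filter_mono nhdsWithin_le_nhds).and hI).exists
      exact ⟨v, ⟨hv1.1, hv1.2⟩, hv2⟩
  have := (hsub (right_mem_Icc.2 zero_le_one)).1
  simpa using this

/-- On an invariant line the time domain is dense. -/
lemma FlowFam.radial {e : ℕ} {V : ℂ → C2 → C2} {F : ℂ → ℂ × C2 → C2} (H : FlowFam e V F)
    {p : C2} {c : ℂ} (hp : V 0 p = c • p) (T : ℂ) {ε : ℝ} (hε : 0 < ε) :
    ∃ T', dist T' T < ε ∧ (T', p) ∈ fdom F := by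
  have key : ∀ (T : ℂ) (s : ℝ → ℂ), s 0 = 1 →
      (∀ u ∈ Icc (0 : ℝ) 1, ∀ᶠ v in nhds u, HasDerivAt s (T * c * s v ^ (e + 1)) v) →
      (T, p) ∈ fdom F := by
    intro T s h0 hs
    refine H.segment (z := fun u => s u • p) (by simp [h0]) ?_
    intro u hu
    filter_upwards [hs u hu] with v hv
    rw [H.hom, hp]
    have := hv.smul_const p
    have heq : T • s v ^ (e + 1) • c • p = (T * c * s v ^ (e + 1)) • p := by
      simp only [smul_smul]
      congr 1
      ring
    rw [heq]
    exact this
  rcases Nat.eq_zero_or_pos e with he | he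
  · refine ⟨T, by simpa using hε, key T (fun u => Complex.exp (T * c * u)) (by simp) ?_⟩
    intro u _
    refine Eventually.of_forall fun v => ?_
    have h1 : HasDerivAt (fun u : ℝ => T * c * (u : ℂ)) (T * c) v := by
      simpa using (Complex.ofRealCLM.hasDerivAt (x := v)).const_mul (T * c)
    have := h1.cexp
    subst he
    have heq : T * c * Complex.exp (T * c * (v : ℂ)) ^ (0 + 1)
        = Complex.exp (T * c * (v : ℂ)) * (T * c) := by ring
    rw [heq]
    exact this
  · have he0 : (e : ℂ) ≠ 0 := by exact_mod_cast he.ne'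
    have hgood : ∀ T : ℂ, (c = 0 ∨ ((e : ℂ) * c * T).im ≠ 0) → (T, p) ∈ fdom F := by
      intro T hT
      have hslit : ∀ u : ℝ, 1 - (e : ℂ) * c * T * u ∈ Complex.slitPlane := by
        intro u
        rcases hT with hT | hT
        · simp [hT]
        · rcases eq_or_ne u 0 with hu | hu
          · simp [hu]
          · rw [Complex.mem_slitPlane_iff]
            right
            rw [Complex.sub_im, Complex.im_mul_ofReal, Complex.one_im, zero_sub]
            exact neg_ne_zero.2 (mul_ne_zero hT hu)
      refine key T (fun u => (1 - (e : ℂ) * c * T * u) ^ (-(1 / (e : ℂ)))) (by simp) ?_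
      intro u _
      refine Eventually.of_forall fun v => ?_
      have h1 : HasDerivAt (fun u : ℝ => 1 - (e : ℂ) * c * T * (u : ℂ)) (-((e : ℂ) * c * T)) v := by
        simpa using ((Complex.ofRealCLM.hasDerivAt (x := v)).const_mul
          ((e : ℂ) * c * T)).const_sub 1
      have h2 : HasDerivAt (fun w : ℂ => w ^ (-(1 / (e : ℂ))))
          ((-(1 / (e : ℂ))) * (1 - (e : ℂ) * c * T * v) ^ (-(1 / (e : ℂ)) - 1))
          (1 - (e : ℂ) * c * T * v) := by
        have h0 := (hasDerivAt_id (1 - (e : ℂ) * c * T * v)).cpow_const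
          (c := -(1 / (e : ℂ))) (hslit v)
        simp only [id, mul_one] at h0
        exact h0
      have h3 := HasDerivAt.scomp v h2 h1
      have hexp : ((e + 1 : ℕ) : ℂ) * (-(1 / (e : ℂ))) = -(1 / (e : ℂ)) - 1 := by
        push_cast; field_simp; ring
      have heq : T * c * ((1 - (e : ℂ) * c * T * v) ^ (-(1 / (e : ℂ)))) ^ (e + 1)
          = (-((e : ℂ) * c * T)) •
            ((-(1 / (e : ℂ))) * (1 - (e : ℂ) * c * T * v) ^ (-(1 / (e : ℂ)) - 1)) := by
        rw [← Complex.cpow_nat_mul, hexp, smul_eq_mul]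
        field_simp
      rw [heq]
      exact h3
    by_cases hc : c = 0
    · exact ⟨T, by simpa using hε, hgood T (Or.inl hc)⟩
    by_cases hT : ((e : ℂ) * c * T).im ≠ 0
    · exact ⟨T, by simpa using hε, hgood T (Or.inr hT)⟩
    · push Not at hT
      set a : ℂ := (e : ℂ) * c with ha
      have ha0 : a ≠ 0 := mul_ne_zero he0 hc
      have han : 0 < ‖a‖ := norm_pos_iff.2 ha0
      let τ : ℝ := ε / 2 * ‖a‖
      have hτ : 0 < τ := by positivity
      refine ⟨T + τ * Complex.I / a, ?_, hgood _ (Or.inr ?_)⟩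
      · rw [dist_eq_norm, add_sub_cancel_left, norm_div, norm_mul, Complex.norm_I, mul_one,
          Complex.norm_real, Real.norm_of_nonneg hτ.le]
        simp only [τ]
        rw [mul_div_assoc, div_self han.ne']
        linarith
      · rw [mul_add, mul_div_cancel₀ _ ha0]
        simp [hT, hτ.ne']

lemma FlowFam.escape_aux {e : ℕ} {V : ℂ → C2 → C2} {F : ℂ → ℂ × C2 → C2} (H : FlowFam e V F)
    {T : ℂ} {p k : C2} (h : ∀ ε > 0, ∃ T', dist T' T < ε ∧ (T', p) ∈ fdom F ∧
      dist (flim F (T', p)) k < ε) : (T, p) ∈ fdom F := by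
  obtain ⟨δ, hδ, hbox⟩ := H.boxball k one_pos
  obtain ⟨T', h1, h2, h3⟩ := h δ hδ
  have := (H.comp (a := T - T') h2 (hbox _ (by rwa [← dist_eq_norm, dist_comm]) _ h3).1).1
  rwa [sub_add_cancel] at this

/-- The graph of the limit flow is closed. -/
lemma FlowFam.closed_graph {e : ℕ} {V : ℂ → C2 → C2} {F : ℂ → ℂ × C2 → C2}
    (H : FlowFam e V F) {s : ℕ → ℂ × C2} {T : ℂ} {p k : C2} (hs : ∀ n, s n ∈ fdom F)
    (hq : Tendsto s atTop (nhds (T, p))) (hk : Tendsto (fun n => flim F (s n)) atTop (nhds k)) :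
    (T, p) ∈ fdom F := by
  have hT : Tendsto (fun n => (s n).1) atTop (nhds T) := (continuous_fst.tendsto _).comp hq
  have hp : Tendsto (fun n => (s n).2) atTop (nhds p) := (continuous_snd.tendsto _).comp hq
  apply H.escape_aux (k := k)
  intro ε hε
  by_cases hrad : ∃ c : ℂ, V 0 p = c • p
  · obtain ⟨c, hc⟩ := hrad
    obtain ⟨δ, hδ, hbox⟩ := H.boxball k (half_pos hε)
    obtain ⟨T', hT', hTd⟩ := H.radial hc T (lt_min hε hδ)
    refine ⟨T', hT'.trans_le (min_le_left _ _), hTd, ?_⟩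
    have hlim : Tendsto (fun n => flim F (T', (s n).2)) atTop (nhds (flim F (T', p))) :=
      (H.cont hTd).tendsto.comp (tendsto_const_nhds.prodMk_nhds hp)
    have hT2 : ∀ᶠ n in atTop, ‖T' - (s n).1‖ < δ := by
      have h1 : Tendsto (fun n => ‖T' - (s n).1‖) atTop (nhds ‖T' - T‖) :=
        (tendsto_const_nhds.sub hT).norm
      refine h1.eventually (gt_mem_nhds ?_)
      rw [← dist_eq_norm]
      exact hT'.trans_le (min_le_right _ _)
    have hle : dist (flim F (T', p)) k ≤ ε / 2 := by
      refine le_of_tendsto (hlim.dist tendsto_const_nhds) ?_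
      filter_upwards [hT2, hk (ball_mem_nhds k hδ)] with n hn1 hn2
      have hb := hbox _ hn1 _ hn2
      have := (H.comp (a := T' - (s n).1) (b := (s n).1) (p := (s n).2) (hs n) hb.1).2
      rw [sub_add_cancel] at this
      rw [this]
      exact hb.2.le
    linarith
  · -- the radial direction is transverse to the field at `p`
    let E : ℂ × ℂ → C2 := fun x => flim F (x.1, x.2 • p)
    obtain ⟨L, hL, hL1⟩ := H.strict (H.box p)
    have hL2 : ∀ v : C2, L (0, v) = v := by
      intro v
      have h1 : HasFDerivAt (fun v : C2 => ((0 : ℂ), v)) (ContinuousLinearMap.inr ℂ ℂ C2) p :=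
        (ContinuousLinearMap.inr ℂ ℂ C2).hasFDerivAt
      have h2 := HasFDerivAt.comp p hL.hasFDerivAt h1
      have h3 : flim F ∘ (fun v : C2 => ((0 : ℂ), v)) = id := by
        funext v; exact H.flim_zero v
      rw [h3] at h2
      have h4 := h2.unique (hasFDerivAt_id p)
      have := congrArg (fun M : C2 →L[ℂ] C2 => M v) h4
      simpa using this
    rw [H.flim_zero] at hL1
    let J : ℂ × ℂ →L[ℂ] ℂ × C2 :=
      (ContinuousLinearMap.fst ℂ ℂ ℂ).prod ((ContinuousLinearMap.snd ℂ ℂ ℂ).smulRight p)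
    have hE : HasStrictFDerivAt E (L.comp J) (0, 1) := by
      have h1 : HasStrictFDerivAt (fun x : ℂ × ℂ => ((x.1, x.2 • p) : ℂ × C2)) J (0, 1) :=
        J.hasStrictFDerivAt
      refine HasStrictFDerivAt.comp (0, 1) ?_ h1
      simpa using hL
    have hLJ : ∀ a b : ℂ, L.comp J (a, b) = a • V 0 p + b • p := by
      intro a b
      have : J (a, b) = a • ((1 : ℂ), (0 : C2)) + b • ((0 : ℂ), p) := by
        simp [J]
      rw [ContinuousLinearMap.comp_apply, this, map_add, map_smul, map_smul, hL1, hL2]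
    have hdet : det2 (V 0 p) p ≠ 0 := by
      intro h0
      apply hrad
      by_cases hp0 : p = 0
      · refine ⟨0, ?_⟩
        have := H.hom 0 p
        rw [hp0] at this ⊢
        simpa using this
      · unfold det2 at h0
        by_cases h1 : p.1 = 0
        · have h2 : p.2 ≠ 0 := fun h2 => hp0 (Prod.ext h1 h2)
          refine ⟨(V 0 p).2 / p.2, ?_⟩
          ext
          · rw [h1] at h0
            have : (V 0 p).1 = 0 := by
              have : (V 0 p).1 * p.2 = 0 := by linear_combination h0
              exact (mul_eq_zero.1 this).resolve_right h2
            simp [h1, this]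
          · simp [h2]
        · refine ⟨(V 0 p).1 / p.1, ?_⟩
          ext
          · simp [h1]
          · simp only [Prod.smul_snd, smul_eq_mul]
            field_simp
            linear_combination -h0
    have hsurj : ((L.comp J : ℂ × ℂ →L[ℂ] C2) : ℂ × ℂ →ₗ[ℂ] C2).range = ⊤ := by
      rw [LinearMap.range_eq_top]
      intro y
      refine ⟨(det2 y p / det2 (V 0 p) p, det2 (V 0 p) y / det2 (V 0 p) p), ?_⟩
      change L.comp J _ = y
      rw [hLJ]
      ext
      · simp only [Prod.fst_add, Prod.smul_fst, smul_eq_mul]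
        rw [div_mul_eq_mul_div, div_mul_eq_mul_div, ← add_div, div_eq_iff hdet]
        unfold det2
        ring
      · simp only [Prod.snd_add, Prod.smul_snd, smul_eq_mul]
        rw [div_mul_eq_mul_div, div_mul_eq_mul_div, ← add_div, div_eq_iff hdet]
        unfold det2
        ring
    have hmap := hE.map_nhds_eq_of_surj hsurj
    have hE0 : E (0, 1) = p := by simp [E, H.flim_zero]
    rw [hE0] at hmap
    -- good parameters
    have hgood : ∀ᶠ x : (ℂ × ℂ) × (ℂ × C2) in nhds (((0 : ℂ), (1 : ℂ)), (T, k)),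
        x.1.2 ≠ 0 ∧ (x.1.1, x.1.2 • p) ∈ fdom F ∧ dist (x.1.2 ^ e * (x.2.1 + x.1.1)) T < ε ∧
        dist (x.1.2⁻¹ • x.2.2) k < ε := by
      refine Eventually.and ?_ (Eventually.and ?_ (Eventually.and ?_ ?_))
      · have : ContinuousAt (fun x : (ℂ × ℂ) × (ℂ × C2) => x.1.2) ((0, 1), (T, k)) := by fun_prop
        exact this.eventually_ne one_ne_zero
      · have : ContinuousAt (fun x : (ℂ × ℂ) × (ℂ × C2) => ((x.1.1, x.1.2 • p) : ℂ × C2))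
          ((0, 1), (T, k)) := by fun_prop
        exact this.eventually ((isOpen_fdom F).mem_nhds (by simpa using H.box p))
      · have : ContinuousAt (fun x : (ℂ × ℂ) × (ℂ × C2) =>
          dist (x.1.2 ^ e * (x.2.1 + x.1.1)) T) ((0, 1), (T, k)) := by fun_prop
        exact this.eventually (gt_mem_nhds (by simpa using hε))
      · have : ContinuousAt (fun x : (ℂ × ℂ) × (ℂ × C2) =>
          dist (x.1.2⁻¹ • x.2.2) k) ((0, 1), (T, k)) := by
          have h1 : ContinuousAt (fun x : (ℂ × ℂ) × (ℂ × C2) => x.1.2⁻¹) ((0, 1), (T, k)) :=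
            ContinuousAt.inv₀ (by fun_prop) (by simp)
          exact (h1.smul (by fun_prop)).dist continuousAt_const
        exact this.eventually (gt_mem_nhds (by simpa using hε))
    rw [nhds_prod_eq] at hgood
    obtain ⟨PA, hPA, PB, hPB, hAB⟩ := eventually_prod_iff.1 hgood
    have h1 : ∀ᶠ n in atTop, PB ((s n).1, flim F (s n)) := (hT.prodMk_nhds hk).eventually hPB
    have h2 : ∀ᶠ n in atTop, (s n).2 ∈ E '' {x | PA x} :=
      hp.eventually (by rw [← hmap]; exact image_mem_map hPA)
    obtain ⟨n, hn1, ⟨t, c⟩, hn2, hn3⟩ := (h1.and h2).exists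
    obtain ⟨g1, g2, g3, g4⟩ := hAB hn2 hn1
    have hn3' : flim F (t, c • p) = (s n).2 := hn3
    have h5 := H.comp (a := (s n).1) (b := t) (p := c • p) g2 (by rw [hn3']; exact hs n)
    rw [hn3'] at h5
    have h6 := H.scaling g1 h5.1
    refine ⟨_, g3, h6.1, ?_⟩
    rw [h6.2, h5.2]
    exact g4

lemma FlowFam.semicomplete {e : ℕ} {V : ℂ → C2 → C2} {F : ℂ → ℂ × C2 → C2}
    (H : FlowFam e V F) : IsSemicompleteOn (V 0) univ ∅ := by
  refine ⟨fdom F, flim F, isOpen_fdom F, by simp, fun p _ => H.box p, by simp, ?_,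
    fun p _ => H.flim_zero p, ?_, ?_, ?_⟩
  · intro q hq
    obtain ⟨L, hL, -⟩ := H.strict hq
    exact hL.hasFDerivAt.differentiableAt
  · intro p _
    have := H.hasDeriv (H.box p)
    rwa [H.flim_zero] at this
  · intro a b p _ hb ha
    exact (H.comp hb ha).2
  · intro s q hs hq hsq K _ hK
    by_contra hcon
    rw [not_eventually] at hcon
    simp only [not_not] at hcon
    obtain ⟨φ, hφ, hφK⟩ := extraction_of_frequently_atTop hcon
    obtain ⟨k, -, ψ, hψ, hk⟩ := hK.tendsto_subseq hφK
    have hin : q ∈ fdom F := H.closed_graph (s := fun n => s (φ (ψ n))) (T := q.1) (p := q.2)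
      (fun n => hs _) (hsq.comp (hφ.tendsto_atTop.comp hψ.tendsto_atTop)) hk
    rw [(isOpen_fdom F).frontier_eq] at hq
    exact hq.2 hin

lemma pev_contDiff (P : MvPolynomial (Fin 2) ℂ) : ContDiff ℂ 1 (pev P) := by
  induction P using MvPolynomial.induction_on with
  | C a =>
    have : pev (MvPolynomial.C a) = fun _ => a := by funext z; simp [pev]
    rw [this]; exact contDiff_const
  | add p q hp hq =>
    have : pev (p + q) = fun z => pev p z + pev q z := by funext z; simp [pev]
    rw [this]; exact hp.add hq
  | mul_X p i hp =>
    fin_cases i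
    · have : pev (p * MvPolynomial.X 0) = fun z => pev p z * z.1 := by funext z; simp [pev]
      exact this ▸ hp.mul contDiff_fst
    · have : pev (p * MvPolynomial.X 1) = fun z => pev p z * z.2 := by funext z; simp [pev]
      exact this ▸ hp.mul contDiff_snd

lemma pev_homog (P : MvPolynomial (Fin 2) ℂ) (i : ℕ) (c : ℂ) (z : C2) :
    pev (MvPolynomial.homogeneousComponent i P) (c • z)
      = c ^ i * pev (MvPolynomial.homogeneousComponent i P) z := by
  have h := MvPolynomial.homogeneousComponent_isHomogeneous i P
  unfold pev
  rw [MvPolynomial.eval_eq', MvPolynomial.eval_eq', Finset.mul_sum]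
  refine Finset.sum_congr rfl fun m hm => ?_
  have hdeg : m 0 + m 1 = i := by
    have h1 := h (MvPolynomial.mem_support_iff.1 hm)
    have h2 : m.degree = i := by
      rw [Finsupp.degree_eq_weight_one]
      exact h1
    rw [Finsupp.degree_eq_sum, Fin.sum_univ_two] at h2
    exact h2
  rw [← hdeg]
  simp only [Fin.prod_univ_two, Matrix.cons_val_zero, Matrix.cons_val_one, Prod.smul_fst,
    Prod.smul_snd, smul_eq_mul, mul_pow, pow_add]
  ring

lemma pev_sum (P : MvPolynomial (Fin 2) ℂ) {d : ℕ} (hd : P.totalDegree ≤ d) (z : C2) :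
    pev P z = ∑ i ∈ Finset.range (d + 1), pev (MvPolynomial.homogeneousComponent i P) z := by
  have h : ∑ i ∈ Finset.range (d + 1), MvPolynomial.homogeneousComponent i P = P := by
    conv_rhs => rw [← MvPolynomial.sum_homogeneousComponent P]
    symm
    apply Finset.sum_subset
    · intro i hi
      simp only [Finset.mem_range] at hi ⊢
      omega
    · intro i _ hi
      simp only [Finset.mem_range] at hi
      exact MvPolynomial.homogeneousComponent_eq_zero _ _ (by omega)
  conv_lhs => rw [← h]
  unfold pev
  rw [map_sum]

/-- The rescaled polynomial. -/
def resc (d : ℕ) (P : MvPolynomial (Fin 2) ℂ) (l : ℂ) (z : C2) : ℂ :=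
  ∑ i ∈ Finset.range (d + 1), l ^ (d - i) * pev (MvPolynomial.homogeneousComponent i P) z

lemma resc_zero (d : ℕ) (P : MvPolynomial (Fin 2) ℂ) (z : C2) :
    resc d P 0 z = pev (MvPolynomial.homogeneousComponent d P) z := by
  unfold resc
  rw [Finset.sum_eq_single d]
  · simp
  · intro i hi hne
    simp only [Finset.mem_range] at hi
    rw [zero_pow (by omega), zero_mul]
  · intro h
    exact absurd (Finset.self_mem_range_succ d) h

lemma resc_ne (d : ℕ) (P : MvPolynomial (Fin 2) ℂ) (hd : P.totalDegree ≤ d) (l : ℂ)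
    (z : C2) : resc d P l (l • z) = l ^ d * pev P z := by
  rw [pev_sum P hd]
  unfold resc
  rw [Finset.mul_sum]
  refine Finset.sum_congr rfl fun i hi => ?_
  simp only [Finset.mem_range] at hi
  rw [pev_homog, ← mul_assoc, ← pow_add]
  congr 2
  omega

lemma resc_cont (d : ℕ) (P : MvPolynomial (Fin 2) ℂ) :
    Continuous (fun q : ℂ × C2 => resc d P q.1 q.2) := by
  unfold resc
  refine continuous_finsetSum _ fun i _ => ?_
  exact (continuous_fst.pow _).mul ((pev_contDiff _).continuous.comp continuous_snd)

lemma flowFam_of {P Q : MvPolynomial (Fin 2) ℂ} {X : C2 → C2}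
    (hX : ∀ z, X z = (pev P z, pev Q z)) {e : ℕ} (hP : P.totalDegree ≤ e + 1)
    (hQ : Q.totalDegree ≤ e + 1) {Φ : ℂ → C2 → C2}
    (hdiff : Differentiable ℂ fun q : ℂ × C2 => Φ q.1 q.2)
    (hzero : ∀ p, Φ 0 p = p)
    (hadd : ∀ t s p, Φ (t + s) p = Φ t (Φ s p))
    (hder : ∀ p, HasDerivAt (fun T => Φ T p) (X p) 0) :
    FlowFam e (fun l z => (resc (e + 1) P l z, resc (e + 1) Q l z))
      (fun l q => l • Φ (l ^ e * q.1) (l⁻¹ • q.2)) where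
  contV := (resc_cont _ P).prodMk (resc_cont _ Q)
  lip z := by
    have h : ContDiff ℂ 1 (fun z : C2 => (resc (e + 1) P 0 z, resc (e + 1) Q 0 z)) := by
      simp only [resc_zero]
      exact (pev_contDiff _).prodMk (pev_contDiff _)
    exact h.contDiffAt.exists_lipschitzOnWith
  diff l _ := by
    have h1 : Differentiable ℂ (fun q : ℂ × C2 => ((l ^ e * q.1, l⁻¹ • q.2) : ℂ × C2)) := by
      fun_prop
    exact (hdiff.comp h1).const_smul l
  zero l hl p := by
    simp [hzero, smul_smul, hl]
  add l hl t s p := by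
    simp only [smul_smul, inv_mul_cancel₀ hl, one_smul]
    rw [← hadd, mul_add]
  ode l hl t p := by
    have hΦ : ∀ t p, HasDerivAt (fun T => Φ T p) (X (Φ t p)) t := by
      intro t p
      have h1 : HasDerivAt (fun T : ℂ => T - t) 1 t := by
        simpa using (hasDerivAt_id t).sub_const t
      have h0 := hder (Φ t p)
      rw [← sub_self t] at h0
      have h2 := HasDerivAt.scomp (h := fun T : ℂ => T - t) (g₁ := fun T => Φ T (Φ t p)) t h0 h1
      rw [one_smul] at h2
      refine h2.congr_of_eventuallyEq (Eventually.of_forall fun T => ?_)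
      change Φ T p = Φ (T - t) (Φ t p)
      rw [← hadd, sub_add_cancel]
    have h1 : HasDerivAt (fun T : ℂ => l ^ e * T) (l ^ e) t := by
      simpa using (hasDerivAt_id t).const_mul (l ^ e)
    have h2 := (HasDerivAt.scomp (g₁ := fun T => Φ T (l⁻¹ • p)) t
      (hΦ (l ^ e * t) (l⁻¹ • p)) h1).const_smul l
    have heq : (resc (e + 1) P l (l • Φ (l ^ e * t) (l⁻¹ • p)),
        resc (e + 1) Q l (l • Φ (l ^ e * t) (l⁻¹ • p)))
        = l • l ^ e • X (Φ (l ^ e * t) (l⁻¹ • p)) := by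
      rw [resc_ne _ P hP, resc_ne _ Q hQ, hX, smul_smul, pow_succ']
      rfl
    simp only
    rw [heq]
    exact h2
  scal l hl c hc t p := by
    have h1 : (l / c) ^ e * (c ^ e * t) = l ^ e * t := by
      rw [← mul_assoc, ← mul_pow, div_mul_cancel₀ _ hc]
    simp only
    rw [h1, smul_smul, smul_smul, mul_div_cancel₀ _ hc, inv_div, div_eq_inv_mul]
  hom c z := by
    simp only [resc_zero, pev_homog, Prod.smul_mk, smul_eq_mul]

/-- The top-degree homogeneous component of a complete polynomial vector field on ℂ² is
semi-complete on the entire ℂ². -/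
theorem top_degree_component_semicomplete
    (P Q : MvPolynomial (Fin 2) ℂ) (X : C2 → C2)
    (hX : ∀ z, X z = (pev P z, pev Q z))
    (hcomp : IsCompleteVF X)
    (d : ℕ) (hd : d = max P.totalDegree Q.totalDegree)
    (Xd : C2 → C2)
    (hXd : ∀ z, Xd z = (pev (MvPolynomial.homogeneousComponent d P) z,
      pev (MvPolynomial.homogeneousComponent d Q) z)) :
    IsSemicompleteOn Xd univ ∅ := by
  obtain ⟨Φ, hdiff, hzero, hadd, hder⟩ := hcomp
  have hP : P.totalDegree ≤ d := hd ▸ le_max_left _ _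
  have hQ : Q.totalDegree ≤ d := hd ▸ le_max_right _ _
  clear hd
  rcases d with _ | e
  · have hXX : Xd = X := by
      funext z
      rw [hXd, hX, pev_sum P hP, pev_sum Q hQ]
      simp only [zero_add, Finset.sum_range_one]
    rw [hXX]
    refine ⟨univ, fun q => Φ q.1 q.2, isOpen_univ, by simp, by simp, by simp,
      fun q _ => hdiff q, fun p _ => hzero p, fun p _ => hder p,
      fun a b p _ _ _ => hadd a b p, ?_⟩
    intro s q _ hq
    simp at hq
  · have H := (flowFam_of hX hP hQ hdiff hzero hadd hder).semicomplete
    have hXX : Xd = fun z => (resc (e + 1) P 0 z, resc (e + 1) Q 0 z) := by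
      funext z
      rw [hXd, resc_zero, resc_zero]
    rw [hXX]
    exact H

end
end

section
/- Let X be a complete polynomial vector field on ℂ² whose induced foliation F_X on ℂℙ² leaves the line at infinity Δ invariant. Then Δ contains at most 3 singularities of F_X. -/
open Metric Set Filter Asymptotics

noncomputable section

lemma flow_hasDeriv {X : C2 → C2} {Φ : ℂ → C2 → C2}
    (hg : ∀ t s p, Φ (t + s) p = Φ t (Φ s p))
    (hd : ∀ p, HasDerivAt (fun T => Φ T p) (X p) 0) (t : ℂ) (p : C2) :
    HasDerivAt (fun T => Φ T p) (X (Φ t p)) t := by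
  have h := hd (Φ t p)
  have h2 : HasDerivAt (fun T => Φ (T - t) (Φ t p)) (X (Φ t p)) t := by
    apply HasDerivAt.comp_sub_const (f := fun T => Φ T (Φ t p)) t t
    simpa using h
  refine h2.congr_of_eventuallyEq (Eventually.of_forall fun T => ?_)
  simp only [← hg, sub_add_cancel]

lemma loop_closed (F : ℝ → C2 → C2) (hF : ContDiff ℝ 1 (fun q : ℝ × C2 => F q.1 q.2))
    (hc : ∀ δ, 0 < δ → IsCompleteVF (F δ)) (c c' : ℝ → ℂ) (z : ℝ → C2)
    (hcd : ∀ s, HasDerivAt c (c' s) s) (hc' : Continuous c')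
    (hz : ∀ s, HasDerivAt z (c' s • F 0 (z s)) s) (h01 : c 1 = c 0) : z 1 = z 0 := by
  have hzc : Continuous z := continuous_iff_continuousAt.2 fun s => (hz s).continuousAt
  obtain ⟨ρ, hρ⟩ : ∃ ρ, ∀ s ∈ Icc (0:ℝ) 1, ‖z s‖ ≤ ρ :=
    isCompact_Icc.exists_bound_of_continuousOn hzc.continuousOn
  obtain ⟨B, hB⟩ : ∃ B, ∀ s ∈ Icc (0:ℝ) 1, ‖c' s‖ ≤ B :=
    isCompact_Icc.exists_bound_of_continuousOn hc'.continuousOn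
  have hB0 : 0 ≤ B := (norm_nonneg _).trans (hB 0 (by simp))
  obtain ⟨L, hL⟩ : ∃ L, LipschitzOnWith L (fun q : ℝ × C2 => F q.1 q.2)
      (Icc (0:ℝ) 1 ×ˢ closedBall (0:C2) (ρ+1)) :=
    hF.contDiffOn.exists_lipschitzOnWith (by norm_num)
      ((convex_Icc _ _).prod (convex_closedBall _ _))
      (isCompact_Icc.prod (isCompact_closedBall _ _))
  set K : NNReal := ⟨B, hB0⟩ * L + 1 with hK
  have hK1 : (K : ℝ) = B * L + 1 := rfl
  have hKpos : (0:ℝ) < K := by rw [hK1]; positivity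
  have key : ∀ δ : ℝ, 0 < δ → δ ≤ 1 → δ * Real.exp K ≤ 1/2 →
      dist (z 0) (z 1) ≤ δ * Real.exp K := by
    intro δ hδ hδ1 hδK
    obtain ⟨Φ, -, h0, hg, hd⟩ := hc δ hδ
    set w : ℝ → C2 := fun s => Φ (c s - c 0) (z 0) with hw
    have hwd : ∀ s, HasDerivAt w (c' s • F δ (w s)) s := fun s =>
      HasDerivAt.scomp (g₁ := fun T => Φ T (z 0)) s
        (flow_hasDeriv hg hd _ _) ((hcd s).sub_const _)
    have hwc : Continuous w := continuous_iff_continuousAt.2 fun s => (hwd s).continuousAt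
    have hw0 : w 0 = z 0 := by simp [hw, h0]
    have hw1 : w 1 = z 0 := by simp [hw, h0, h01]
    have gr : ∀ b ∈ Icc (0:ℝ) 1, (∀ s ∈ Ico 0 b, dist (w s) (z s) ≤ 1) →
        dist (w b) (z b) ≤ δ * Real.exp K := by
      intro b hb hbd
      have hwK : ∀ s ∈ Ico 0 b, w s ∈ closedBall (0:C2) (ρ+1) := by
        intro s hs
        have h1 := hρ s ⟨hs.1, hs.2.le.trans hb.2⟩
        have h2 := hbd s hs
        rw [mem_closedBall]
        calc dist (w s) 0 ≤ dist (w s) (z s) + dist (z s) 0 := dist_triangle _ _ _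
          _ ≤ 1 + ρ := by rw [dist_zero_right]; gcongr
          _ = ρ + 1 := add_comm _ _
      have hzK : ∀ s ∈ Ico 0 b, z s ∈ closedBall (0:C2) (ρ+1) := by
        intro s hs
        have h1 := hρ s ⟨hs.1, hs.2.le.trans hb.2⟩
        rw [mem_closedBall, dist_zero_right]; linarith
      have := dist_le_of_approx_trajectories_ODE_of_mem (v := fun s y => c' s • F 0 y) (K := K)
        (s := fun _ => closedBall (0:C2) (ρ+1)) (f := w) (g := z) (a := 0) (b := b)
        (f' := fun s => c' s • F δ (w s)) (g' := fun s => c' s • F 0 (z s))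
        (εf := K * δ) (εg := 0) (δ := 0) ?_ hwc.continuousOn
        (fun t _ => (hwd t).hasDerivWithinAt) ?_ hwK hzc.continuousOn
        (fun t _ => (hz t).hasDerivWithinAt) (by simp) hzK (by simp [hw0]) b ⟨hb.1, le_rfl⟩
      · refine this.trans ?_
        rw [gronwallBound_of_K_ne_0 hKpos.ne']
        have : Real.exp (K * (b - 0)) ≤ Real.exp K := by
          apply Real.exp_le_exp.2
          nlinarith [hb.2]
        have e : (K * δ + 0) / (K:ℝ) = δ := by field_simp; ring
        rw [e]; nlinarith
      · intro t ht
        have hct := hB t ⟨ht.1, ht.2.le.trans hb.2⟩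
        refine LipschitzOnWith.of_dist_le_mul fun x hx y hy => ?_
        have := hL.dist_le_mul (0, x) ⟨by simp, hx⟩ (0, y) ⟨by simp, hy⟩
        rw [dist_smul₀]
        have e : dist ((0:ℝ), x) ((0:ℝ), y) = dist x y := by simp [Prod.dist_eq]
        rw [e] at this
        calc ‖c' t‖ * dist (F 0 x) (F 0 y) ≤ B * (L * dist x y) := by gcongr
          _ ≤ K * dist x y := by rw [hK1]; nlinarith [dist_nonneg (x := x) (y := y)]
      · intro t ht
        have hct := hB t ⟨ht.1, ht.2.le.trans hb.2⟩
        have := hL.dist_le_mul (δ, w t) ⟨⟨hδ.le, hδ1⟩, hwK t ht⟩ (0, w t) ⟨by simp, hwK t ht⟩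
        have e : dist (δ, w t) ((0:ℝ), w t) = δ := by simp [Prod.dist_eq, abs_of_pos hδ, hδ.le]
        rw [e] at this
        rw [dist_smul₀]
        calc ‖c' t‖ * dist (F δ (w t)) (F 0 (w t)) ≤ B * (L * δ) := by gcongr
          _ ≤ K * δ := by rw [hK1]; nlinarith
    have hlt : ∀ s ∈ Icc (0:ℝ) 1, dist (w s) (z s) < 1 := by
      by_contra! hne
      set S : Set ℝ := Icc (0:ℝ) 1 ∩ {s | 1 ≤ dist (w s) (z s)}
      have hS : IsCompact S := isCompact_Icc.inter_right
        (isClosed_le continuous_const (hwc.dist hzc))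
      obtain ⟨s₀, hs₀, hmin⟩ := hS.exists_isLeast hne
      have := gr s₀ hs₀.1 (fun s hs => by
        by_contra! hcon
        exact absurd (hmin ⟨⟨hs.1, hs.2.le.trans hs₀.1.2⟩, hcon.le⟩) (not_le.2 hs.2))
      have h2 : 1 ≤ dist (w s₀) (z s₀) := hs₀.2
      linarith
    have := gr 1 (by simp) (fun s hs => (hlt s ⟨hs.1, hs.2.le⟩).le)
    rwa [hw1] at this
  have hlim : Tendsto (fun δ : ℝ => δ * Real.exp K) (nhdsWithin 0 (Ioi 0)) (nhds 0) := by
    have : Tendsto (fun δ : ℝ => δ * Real.exp K) (nhds 0) (nhds (0 * Real.exp K)) :=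
      (continuous_id.mul continuous_const).tendsto 0
    rw [zero_mul] at this
    exact this.mono_left nhdsWithin_le_nhds
  have hd0 : dist (z 0) (z 1) ≤ 0 := by
    refine ge_of_tendsto hlim ?_
    have h1 : ∀ᶠ δ in nhdsWithin (0:ℝ) (Ioi 0), δ * Real.exp K < 1/2 :=
      hlim.eventually (gt_mem_nhds (by norm_num))
    have h2 : ∀ᶠ δ in nhdsWithin (0:ℝ) (Ioi 0), δ < 1 :=
      nhdsWithin_le_nhds (gt_mem_nhds (by norm_num))
    filter_upwards [h1, h2, self_mem_nhdsWithin] with δ a b e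
    exact key δ e b.le a.le
  exact (dist_le_zero.1 hd0).symm

/-- Periods of the monomial field. -/
lemma monomial_int (F : ℝ → C2 → C2) (hF : ContDiff ℝ 1 (fun q : ℝ × C2 => F q.1 q.2))
    (hc : ∀ δ, 0 < δ → IsCompleteVF (F δ)) (b k : ℕ) (p q : ℂ)
    (h0 : ∀ x y, F 0 (x, y) = (p * x ^ (b+1) * y ^ k, q * x ^ b * y ^ (k+1)))
    (hσ : p * b + q * k ≠ 0) :
    ∃ α β : ℤ, p = α * (p * b + q * k) ∧ q = β * (p * b + q * k) := by
  set σ := p * b + q * k with hs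
  set w : ℂ := 2 * Real.pi * Complex.I with hw
  have hw0 : w ≠ 0 := Complex.two_pi_I_ne_zero
  have hexp : ∀ (a : ℂ) (s : ℝ), HasDerivAt (fun s : ℝ => Complex.exp (a * s))
      (a * Complex.exp (a * s)) s := by
    intro a s
    have h1 : HasDerivAt (fun s : ℝ => (s : ℂ)) 1 s := Complex.ofRealCLM.hasDerivAt
    have := (h1.const_mul a).cexp
    simpa [mul_comm] using this
  have := loop_closed F hF hc (fun s => -(1/σ) * Complex.exp (w * s))
    (fun s => -(1/σ) * (w * Complex.exp (w * s)))
    (fun s => (Complex.exp (-(p/σ) * w * s), Complex.exp (-(q/σ) * w * s)))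
    (fun s => (hexp w s).const_mul _) (by fun_prop) ?_ ?_
  · simp only [Prod.mk.injEq, Complex.ofReal_one, mul_one, Complex.ofReal_zero, mul_zero,
      Complex.exp_zero, Complex.exp_eq_one_iff] at this
    obtain ⟨⟨n, hn⟩, ⟨m, hm⟩⟩ := this
    refine ⟨-n, -m, ?_, ?_⟩
    · have := mul_right_cancel₀ hw0 hn
      push_cast; rw [← this]; field_simp
    · have := mul_right_cancel₀ hw0 hm
      push_cast; rw [← this]; field_simp
  · intro s
    have h := (hexp (-(p/σ) * w) s).prodMk (hexp (-(q/σ) * w) s)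
    convert h using 1
    rw [h0]
    have hkey : Complex.exp (w * s) * (Complex.exp (-(p/σ) * w * s) ^ b *
        Complex.exp (-(q/σ) * w * s) ^ k) = 1 := by
      rw [← Complex.exp_nat_mul, ← Complex.exp_nat_mul, ← Complex.exp_add, ← Complex.exp_add]
      rw [Complex.exp_eq_one_iff]
      refine ⟨0, ?_⟩
      have : p * b / σ + q * k / σ = 1 := by rw [← add_div, ← hs, div_self hσ]
      push_cast
      linear_combination (-w * s) * this
    generalize Complex.exp (w * s) = E at *
    generalize Complex.exp (-(p/σ) * w * s) = x at *
    generalize Complex.exp (-(q/σ) * w * s) = y at *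
    ext
    · simp only [Prod.smul_mk, smul_eq_mul]
      linear_combination (-(1/σ) * w * p * x) * hkey
    · simp only [Prod.smul_mk, smul_eq_mul]
      linear_combination (-(1/σ) * w * q * y) * hkey
  · simp [hw, Complex.exp_two_pi_mul_I]

lemma complete_conj {X : C2 → C2} (hX : IsCompleteVF X) (A B : C2 →L[ℂ] C2)
    (hAB : ∀ z, A (B z) = z) (hBA : ∀ z, B (A z) = z) (s : ℂ) :
    IsCompleteVF (fun z => s • B (X (A z))) := by
  obtain ⟨Φ, h1, h0, hg, hd⟩ := hX
  refine ⟨fun t p => B (Φ (s * t) (A p)), ?_, ?_, ?_, ?_⟩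
  · have : Differentiable ℂ (fun q : ℂ × C2 => ((s * q.1, A q.2) : ℂ × C2)) := by fun_prop
    exact B.differentiable.comp (h1.comp this)
  · intro p; simp [h0, hBA]
  · intro t s' p; simp only [hAB, mul_add, hg]
  · intro p
    have h2 : HasDerivAt (fun T => Φ T (A p)) (X (A p)) (s * 0) := by simpa using hd (A p)
    have h3 : HasDerivAt (fun T : ℂ => s * T) s 0 := by simpa using (hasDerivAt_id (0:ℂ)).const_mul s
    have h4 := h2.scomp (0:ℂ) h3
    have h5 := (B.hasFDerivAt (x := Φ (s * 0) (A p))).comp_hasDerivAt (0:ℂ) h4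
    simpa [Function.comp_def] using h5

/-- The exponent `x^i y^j`. -/
def ex (i j : ℕ) : Fin 2 →₀ ℕ := Finsupp.single 0 i + Finsupp.single 1 j

lemma ex_zero (i j : ℕ) : ex i j 0 = i := by simp [ex]
lemma ex_one (i j : ℕ) : ex i j 1 = j := by simp [ex]
lemma eq_ex (m : Fin 2 →₀ ℕ) : m = ex (m 0) (m 1) := by
  ext i; fin_cases i <;> simp [ex]

lemma degree_two (m : Fin 2 →₀ ℕ) : m.degree = m 0 + m 1 := by
  simp [Finsupp.degree_eq_sum, Fin.sum_univ_two]

lemma le_of_mem_support {P : MvPolynomial (Fin 2) ℂ} {d : ℕ} (h : P.totalDegree ≤ d)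
    {m : Fin 2 →₀ ℕ} (hm : m ∈ P.support) : m 0 + m 1 ≤ d := by
  have := (MvPolynomial.le_totalDegree hm).trans h
  rw [← degree_two]; exact this

lemma pev_eq (P : MvPolynomial (Fin 2) ℂ) (x y : ℂ) :
    pev P (x, y) = ∑ m ∈ P.support, P.coeff m * (x ^ m 0 * y ^ m 1) := by
  simp [pev, MvPolynomial.eval_eq', Fin.prod_univ_two]

/-- Weighted rescaling. -/
lemma rescale_int (P Q : MvPolynomial (Fin 2) ℂ) (d k : ℕ) (hP : P.totalDegree ≤ d)
    (hQ : Q.totalDegree ≤ d) (hc : IsCompleteVF (fun z => (pev P z, pev Q z)))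
    (hk : k + 1 ≤ d)
    (hPk : ∀ j < k, P.coeff (ex (d - j) j) = 0)
    (hQk : ∀ j < k + 1, Q.coeff (ex (d - j) j) = 0)
    (p q : ℂ) (hp : p = P.coeff (ex (d - k) k)) (hq : q = Q.coeff (ex (d - (k+1)) (k+1)))
    (hσ : p * (d - 1 - k : ℕ) + q * k ≠ 0) :
    ∃ α β : ℤ, p = α * (p * (d - 1 - k : ℕ) + q * k) ∧ q = β * (p * (d - 1 - k : ℕ) + q * k) := by
  have hPs : ∀ m ∈ P.support, m 0 + m 1 ≤ d ∧ (m 0 + m 1 = d → k ≤ m 1) := by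
    intro m hm
    refine ⟨le_of_mem_support hP hm, fun h => ?_⟩
    by_contra! hlt
    apply MvPolynomial.mem_support_iff.1 hm
    have e : m = ex (d - m 1) (m 1) := by
      conv_lhs => rw [eq_ex m]
      congr 1; omega
    rw [e]; exact hPk _ hlt
  have hQs : ∀ m ∈ Q.support, m 0 + m 1 ≤ d ∧ (m 0 + m 1 = d → k + 1 ≤ m 1) := by
    intro m hm
    refine ⟨le_of_mem_support hQ hm, fun h => ?_⟩
    by_contra! hlt
    apply MvPolynomial.mem_support_iff.1 hm
    have e : m = ex (d - m 1) (m 1) := by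
      conv_lhs => rw [eq_ex m]
      congr 1; omega
    rw [e]; exact hQk _ hlt
  have hge : ∀ n l : ℕ, n ≤ d → (n = d → k ≤ l) → k ≤ (d+1) * (d - n) + l := by
    intro n l h1 h2
    rcases h1.eq_or_lt with h | h
    · have := h2 h; omega
    · have : (d+1) * 1 ≤ (d+1) * (d - n) := Nat.mul_le_mul_left _ (by omega)
      omega
  have hge' : ∀ n l : ℕ, n ≤ d → (n = d → k + 1 ≤ l) → k + 1 ≤ (d+1) * (d - n) + l := by
    intro n l h1 h2
    rcases h1.eq_or_lt with h | h
    · have := h2 h; omega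
    · have : (d+1) * 1 ≤ (d+1) * (d - n) := Nat.mul_le_mul_left _ (by omega)
      omega
  have hexp : ∀ (a b : ℕ), a + b ≤ d → (d+1) * (d - (a+b)) + b + (d+1) * a + d * b = (d+1) * d := by
    intro a b h
    obtain ⟨c, rfl⟩ := Nat.exists_eq_add_of_le h
    rw [Nat.add_sub_cancel_left]; ring
  set F : ℝ → C2 → C2 := fun δ z =>
    (∑ m ∈ P.support, P.coeff m * ((δ:ℂ) ^ ((d+1) * (d - (m 0 + m 1)) + m 1 - k) *
        (z.1 ^ m 0 * z.2 ^ m 1)),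
     ∑ m ∈ Q.support, Q.coeff m * ((δ:ℂ) ^ ((d+1) * (d - (m 0 + m 1)) + m 1 - (k+1)) *
        (z.1 ^ m 0 * z.2 ^ m 1))) with hF
  refine monomial_int F ?_ ?_ (d - 1 - k) k p q ?_ hσ
  · have h1 : ContDiff ℝ 1 (fun q : ℝ × C2 => (q.1 : ℂ)) :=
      Complex.ofRealCLM.contDiff.comp contDiff_fst
    have h2 : ContDiff ℝ 1 (fun q : ℝ × C2 => q.2.1) := by fun_prop
    have h3 : ContDiff ℝ 1 (fun q : ℝ × C2 => q.2.2) := by fun_prop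
    refine ContDiff.prodMk ?_ ?_
    · exact ContDiff.sum fun m _ => contDiff_const.mul ((h1.pow _).mul ((h2.pow _).mul (h3.pow _)))
    · exact ContDiff.sum fun m _ => contDiff_const.mul ((h1.pow _).mul ((h2.pow _).mul (h3.pow _)))
  · intro δ hδ
    have hδ' : (δ:ℂ) ≠ 0 := by exact_mod_cast hδ.ne'
    have := complete_conj hc
      (((1 / (δ:ℂ) ^ (d+1)) • ContinuousLinearMap.fst ℂ ℂ ℂ).prod
        ((1 / (δ:ℂ) ^ d) • ContinuousLinearMap.snd ℂ ℂ ℂ))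
      ((((δ:ℂ) ^ (d+1)) • ContinuousLinearMap.fst ℂ ℂ ℂ).prod
        (((δ:ℂ) ^ d) • ContinuousLinearMap.snd ℂ ℂ ℂ))
      (by intro z; ext <;> simp [hδ']) (by intro z; ext <;> simp [hδ'])
      ((δ:ℂ) ^ ((d+1) * (d-1)) / (δ:ℂ) ^ k)
    convert this using 1
    funext z
    obtain ⟨x, y⟩ := z
    have hd1 : (d+1) * d = (d+1) * (d-1) + (d+1) := by
      obtain ⟨c, rfl⟩ := Nat.exists_eq_add_of_le hk
      have : k + 1 + c - 1 = k + c := by omega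
      rw [this]; ring
    ext
    · simp only [hF, ContinuousLinearMap.prod_apply, smul_apply,
        ContinuousLinearMap.coe_fst', ContinuousLinearMap.coe_snd', Prod.smul_mk, smul_eq_mul,
        pev_eq, Finset.mul_sum]
      refine Finset.sum_congr rfl fun m hm => ?_
      have h1 := hexp (m 0) (m 1) (hPs m hm).1
      have h2 := hge _ _ (hPs m hm).1 (hPs m hm).2
      obtain ⟨e, he⟩ := Nat.exists_eq_add_of_le h2
      rw [he] at h1
      rw [he, Nat.add_sub_cancel_left]
      have h3 : (δ:ℂ)^k * (δ:ℂ)^e * ((δ:ℂ)^(d+1))^(m 0) * ((δ:ℂ)^d)^(m 1) =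
          (δ:ℂ)^((d+1)*(d-1)) * (δ:ℂ)^(d+1) := by
        rw [← pow_mul, ← pow_mul, ← pow_add, ← pow_add, ← pow_add, ← pow_add, h1, hd1]
      rw [mul_pow, mul_pow, one_div, one_div, inv_pow, inv_pow]
      have n1 : ((δ:ℂ)^(d+1))^(m 0) ≠ 0 := by positivity
      have n2 : ((δ:ℂ)^d)^(m 1) ≠ 0 := by positivity
      have n3 : (δ:ℂ)^k ≠ 0 := by positivity
      generalize (δ:ℂ)^((d+1)*(d-1)) = a1 at *
      generalize ((δ:ℂ)^(d+1))^(m 0) = a2 at *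
      generalize ((δ:ℂ)^d)^(m 1) = a3 at *
      generalize (δ:ℂ)^(d+1) = a4 at *
      generalize (δ:ℂ)^k = a5 at *
      field_simp
      linear_combination (P.coeff m * x ^ m 0 * y ^ m 1) * h3
    · simp only [hF, ContinuousLinearMap.prod_apply, smul_apply,
        ContinuousLinearMap.coe_fst', ContinuousLinearMap.coe_snd', Prod.smul_mk, smul_eq_mul,
        pev_eq, Finset.mul_sum]
      refine Finset.sum_congr rfl fun m hm => ?_
      have h1 := hexp (m 0) (m 1) (hQs m hm).1
      have h2 := hge' _ _ (hQs m hm).1 (hQs m hm).2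
      obtain ⟨e, he⟩ := Nat.exists_eq_add_of_le h2
      rw [he] at h1
      rw [he, Nat.add_sub_cancel_left]
      have h3 : (δ:ℂ) * ((δ:ℂ)^k * (δ:ℂ)^e * ((δ:ℂ)^(d+1))^(m 0) * ((δ:ℂ)^d)^(m 1)) =
          (δ:ℂ) * ((δ:ℂ)^((d+1)*(d-1)) * (δ:ℂ)^d) := by
        have : (δ:ℂ)^(k+1+e+(d+1)*m 0+d*m 1) = (δ:ℂ)^((d+1)*(d-1)+(d+1)) := by rw [h1, hd1]
        rw [← pow_mul, ← pow_mul]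
        calc _ = (δ:ℂ)^(k+1+e+(d+1)*m 0+d*m 1) := by ring
          _ = _ := by rw [this]; ring
      have h3 := mul_left_cancel₀ hδ' h3
      rw [mul_pow, mul_pow, one_div, one_div, inv_pow, inv_pow]
      have n1 : ((δ:ℂ)^(d+1))^(m 0) ≠ 0 := by positivity
      have n2 : ((δ:ℂ)^d)^(m 1) ≠ 0 := by positivity
      have n3 : (δ:ℂ)^k ≠ 0 := by positivity
      generalize (δ:ℂ)^((d+1)*(d-1)) = a1 at *
      generalize ((δ:ℂ)^(d+1))^(m 0) = a2 at *
      generalize ((δ:ℂ)^d)^(m 1) = a3 at *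
      generalize (δ:ℂ)^k = a5 at *
      field_simp
      linear_combination (Q.coeff m * x ^ m 0 * y ^ m 1) * h3
  · intro x y
    ext
    · simp only [hF]
      rw [Finset.sum_eq_single (ex (d - k) k)]
      · rw [ex_zero, ex_one, hp]
        have e1 : (d+1) * (d - (d - k + k)) + k - k = 0 := by
          have : d - (d - k + k) = 0 := by omega
          simp [this]
        have e2 : d - 1 - k + 1 = d - k := by omega
        rw [e1, e2]; simp; ring
      · intro m hm hne
        have h1 := hPs m hm
        have : (d+1) * (d - (m 0 + m 1)) + m 1 - k ≠ 0 := by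
          rcases h1.1.eq_or_lt with h | h
          · have h3 := h1.2 h
            have : m 1 ≠ k := by
              intro h4; apply hne; rw [eq_ex m]; congr 1; omega
            omega
          · have : (d+1) * 1 ≤ (d+1) * (d - (m 0 + m 1)) := Nat.mul_le_mul_left _ (by omega)
            omega
        simp [zero_pow this]
      · intro h
        rw [MvPolynomial.notMem_support_iff.1 h]; simp
    · simp only [hF]
      rw [Finset.sum_eq_single (ex (d - (k+1)) (k+1))]
      · rw [ex_zero, ex_one, hq]
        have e1 : (d+1) * (d - (d - (k+1) + (k+1))) + (k+1) - (k+1) = 0 := by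
          have : d - (d - (k+1) + (k+1)) = 0 := by omega
          simp [this]
        have e2 : d - 1 - k = d - (k+1) := by omega
        rw [e1, e2]; simp; ring
      · intro m hm hne
        have h1 := hQs m hm
        have : (d+1) * (d - (m 0 + m 1)) + m 1 - (k+1) ≠ 0 := by
          rcases h1.1.eq_or_lt with h | h
          · have h3 := h1.2 h
            have : m 1 ≠ k+1 := by
              intro h4; apply hne; rw [eq_ex m]; congr 1; omega
            omega
          · have : (d+1) * 1 ≤ (d+1) * (d - (m 0 + m 1)) := Nat.mul_le_mul_left _ (by omega)
            omega
        simp [zero_pow this]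
      · intro h
        rw [MvPolynomial.notMem_support_iff.1 h]; simp

/-- Dehomogenized degree-`d` part. -/
def dh (d : ℕ) (P : MvPolynomial (Fin 2) ℂ) : Polynomial ℂ :=
  MvPolynomial.aeval ![1, Polynomial.X] (MvPolynomial.homogeneousComponent d P)

lemma dh_add (d : ℕ) (P Q : MvPolynomial (Fin 2) ℂ) : dh d (P + Q) = dh d P + dh d Q := by
  simp [dh]
lemma dh_sub (d : ℕ) (P Q : MvPolynomial (Fin 2) ℂ) : dh d (P - Q) = dh d P - dh d Q := by
  simp [dh]
lemma dh_C_mul (d : ℕ) (a : ℂ) (P : MvPolynomial (Fin 2) ℂ) :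
    dh d (MvPolynomial.C a * P) = Polynomial.C a * dh d P := by
  simp [dh, MvPolynomial.homogeneousComponent_C_mul]

lemma dh_coeff (d : ℕ) (P : MvPolynomial (Fin 2) ℂ) (j : ℕ) :
    (dh d P).coeff j = if j ≤ d then P.coeff (ex (d - j) j) else 0 := by
  induction P using MvPolynomial.induction_on' with
  | monomial m a =>
    have h1 : (MvPolynomial.monomial m a).IsHomogeneous (m 0 + m 1) :=
      MvPolynomial.isHomogeneous_monomial a (degree_two m)
    rw [dh, MvPolynomial.homogeneousComponent_of_mem h1, MvPolynomial.coeff_monomial]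
    by_cases hd : d = m 0 + m 1
    · rw [if_pos hd, MvPolynomial.aeval_monomial]
      simp only [Finsupp.prod_fintype, pow_zero, implies_true, Fin.prod_univ_two,
        Matrix.cons_val_zero, Matrix.cons_val_one, one_pow, one_mul]
      rw [← Polynomial.C_eq_algebraMap, Polynomial.coeff_C_mul_X_pow]
      by_cases hj : j = m 1
      · subst hj
        rw [if_pos rfl, if_pos (by omega), if_pos]
        conv_lhs => rw [eq_ex m]
        congr 1; omega
      · rw [if_neg hj, ← ite_and, if_neg]
        rintro ⟨-, h⟩
        apply hj; rw [h, ex_one]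
    · rw [if_neg hd, map_zero, Polynomial.coeff_zero, ← ite_and, if_neg]
      rintro ⟨hj, h⟩
      apply hd; rw [h, ex_zero, ex_one]; omega
  | add p q hp hq =>
    rw [dh_add, Polynomial.coeff_add, hp, hq, MvPolynomial.coeff_add]
    split_ifs <;> simp

lemma dh_eval (d : ℕ) (P : MvPolynomial (Fin 2) ℂ) (v : ℂ) :
    (dh d P).eval v = pev (MvPolynomial.homogeneousComponent d P) (1, v) := by
  have : (Polynomial.aeval v).comp (MvPolynomial.aeval (R := ℂ) ![1, Polynomial.X]) =
      MvPolynomial.aeval (R := ℂ) ![(1:ℂ), v] := by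
    apply MvPolynomial.algHom_ext
    intro i; fin_cases i <;> simp
  have h := DFunLike.congr_fun this (MvPolynomial.homogeneousComponent d P)
  simpa [dh, pev, MvPolynomial.aeval_eq_eval] using h

/-- Linear substitution. -/
def lsub (a b c e : ℂ) : MvPolynomial (Fin 2) ℂ →ₐ[ℂ] MvPolynomial (Fin 2) ℂ :=
  MvPolynomial.aeval ![MvPolynomial.C a * MvPolynomial.X 0 + MvPolynomial.C b * MvPolynomial.X 1,
    MvPolynomial.C c * MvPolynomial.X 0 + MvPolynomial.C e * MvPolynomial.X 1]

lemma pev_lsub (a b c e : ℂ) (P : MvPolynomial (Fin 2) ℂ) (x y : ℂ) :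
    pev (lsub a b c e P) (x, y) = pev P (a * x + b * y, c * x + e * y) := by
  have : (MvPolynomial.aeval (R := ℂ) ![x, y]).comp (lsub a b c e) =
      MvPolynomial.aeval (R := ℂ) ![a * x + b * y, c * x + e * y] := by
    apply MvPolynomial.algHom_ext
    intro i; fin_cases i <;> simp [lsub]
  have h := DFunLike.congr_fun this P
  simpa [pev, MvPolynomial.aeval_eq_eval] using h

lemma lsub_hom (a b c e : ℂ) {P : MvPolynomial (Fin 2) ℂ} {n : ℕ} (h : P.IsHomogeneous n) :
    (lsub a b c e P).IsHomogeneous n := by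
  have := h.aeval (S := ℂ) (n := 1)
    ![MvPolynomial.C a * MvPolynomial.X 0 + MvPolynomial.C b * MvPolynomial.X 1,
    MvPolynomial.C c * MvPolynomial.X 0 + MvPolynomial.C e * (MvPolynomial.X 1 : MvPolynomial (Fin 2) ℂ)] ?_
  · simpa [lsub] using this
  · intro i
    fin_cases i
    · exact ((MvPolynomial.isHomogeneous_C_mul_X _ _)).add (MvPolynomial.isHomogeneous_C_mul_X _ _)
    · exact ((MvPolynomial.isHomogeneous_C_mul_X _ _)).add (MvPolynomial.isHomogeneous_C_mul_X _ _)

lemma lsub_hc (a b c e : ℂ) (P : MvPolynomial (Fin 2) ℂ) (d : ℕ) :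
    MvPolynomial.homogeneousComponent d (lsub a b c e P) =
      lsub a b c e (MvPolynomial.homogeneousComponent d P) := by
  conv_lhs => rw [← MvPolynomial.sum_homogeneousComponent P]
  conv_rhs => rw [← MvPolynomial.sum_homogeneousComponent P]
  simp only [map_sum]
  refine Finset.sum_congr rfl fun i _ => ?_
  have h := MvPolynomial.homogeneousComponent_isHomogeneous i P
  rw [MvPolynomial.homogeneousComponent_of_mem h,
    MvPolynomial.homogeneousComponent_of_mem (lsub_hom a b c e h)]
  split_ifs <;> simp

lemma lsub_deg (a b c e : ℂ) (P : MvPolynomial (Fin 2) ℂ) :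
    (lsub a b c e P).totalDegree ≤ P.totalDegree := by
  conv_lhs => rw [← MvPolynomial.sum_homogeneousComponent P]
  rw [map_sum]
  refine MvPolynomial.totalDegree_finsetSum_le fun i hi => ?_
  have h := lsub_hom a b c e (MvPolynomial.homogeneousComponent_isHomogeneous i P)
  have := Finset.mem_range.1 hi
  exact h.totalDegree_le.trans (by omega)

lemma dh_shift (d : ℕ) (u : ℂ) (P : MvPolynomial (Fin 2) ℂ) :
    dh d (lsub 1 0 u 1 P) = (dh d P).comp (Polynomial.X + Polynomial.C u) := by
  rw [dh, lsub_hc, dh]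
  have : (MvPolynomial.aeval (R := ℂ) ![1, Polynomial.X]).comp (lsub 1 0 u 1) =
      (Polynomial.aeval (Polynomial.X + Polynomial.C u)).comp
        (MvPolynomial.aeval (R := ℂ) ![1, Polynomial.X]) := by
    apply MvPolynomial.algHom_ext
    intro i; fin_cases i <;> simp [lsub, add_comm]
  exact DFunLike.congr_fun this (MvPolynomial.homogeneousComponent d P)

/-- Completeness under an unimodular linear change of coordinates. -/
lemma complete_lsub {P Q : MvPolynomial (Fin 2) ℂ} (a b c e : ℂ) (hdet : a * e - b * c = 1)
    (hc : IsCompleteVF (fun z => (pev P z, pev Q z))) :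
    IsCompleteVF (fun z =>
      (pev (MvPolynomial.C e * lsub a b c e P - MvPolynomial.C b * lsub a b c e Q) z,
       pev (MvPolynomial.C a * lsub a b c e Q - MvPolynomial.C c * lsub a b c e P) z)) := by
  have := complete_conj hc
    ((a • ContinuousLinearMap.fst ℂ ℂ ℂ + b • ContinuousLinearMap.snd ℂ ℂ ℂ).prod
      (c • ContinuousLinearMap.fst ℂ ℂ ℂ + e • ContinuousLinearMap.snd ℂ ℂ ℂ))
    ((e • ContinuousLinearMap.fst ℂ ℂ ℂ - b • ContinuousLinearMap.snd ℂ ℂ ℂ).prod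
      (a • ContinuousLinearMap.snd ℂ ℂ ℂ - c • ContinuousLinearMap.fst ℂ ℂ ℂ))
    (by
      intro z; ext
      · simp; linear_combination z.1 * hdet
      · simp; linear_combination z.2 * hdet)
    (by
      intro z; ext
      · simp; linear_combination z.1 * hdet
      · simp; linear_combination z.2 * hdet) 1
  convert this using 1
  funext z
  obtain ⟨x, y⟩ := z
  have h1 : ∀ P Q : MvPolynomial (Fin 2) ℂ, ∀ z, pev (P - Q) z = pev P z - pev Q z := by
    intros; simp [pev]
  have h2 : ∀ (P : MvPolynomial (Fin 2) ℂ) (a : ℂ) z, pev (MvPolynomial.C a * P) z = a * pev P z := by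
    intros; simp [pev]
  ext <;> simp [h1, h2, pev_lsub]

lemma deg_comb {P Q : MvPolynomial (Fin 2) ℂ} {d : ℕ} (hP : P.totalDegree ≤ d)
    (hQ : Q.totalDegree ≤ d) (a b x y z w : ℂ) :
    (MvPolynomial.C a * lsub x y z w P - MvPolynomial.C b * lsub x y z w Q).totalDegree ≤ d := by
  refine (MvPolynomial.totalDegree_sub _ _).trans (max_le ?_ ?_)
  · refine (MvPolynomial.totalDegree_mul _ _).trans ?_
    simpa using (lsub_deg x y z w P).trans hP
  · refine (MvPolynomial.totalDegree_mul _ _).trans ?_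
    simpa using (lsub_deg x y z w Q).trans hQ

lemma local_zero (P Q : MvPolynomial (Fin 2) ℂ) (d k : ℕ) (hP : P.totalDegree ≤ d)
    (hQ : Q.totalDegree ≤ d) (hc : IsCompleteVF (fun z => (pev P z, pev Q z)))
    (hd : 3 ≤ d) (hk : k + 1 ≤ d) (r : Polynomial ℂ)
    (hr : dh d Q - Polynomial.X * dh d P = Polynomial.X ^ (k+1) * r) (hr0 : r.eval 0 ≠ 0) :
    ∃ p, dh d P = Polynomial.X ^ k * p ∧
      ((d:ℝ) - 2) * (-(k:ℂ) - (d - 1) * (p.eval 0 / r.eval 0)).re ≤ k := by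
  classical
  have hrc : ∀ j, (dh d Q).coeff (j+1) - (dh d P).coeff j =
      (Polynomial.X ^ (k+1) * r).coeff (j+1) := by
    intro j; rw [← hr]; simp
  have hrk : (dh d Q).coeff (k+1) - (dh d P).coeff k = r.eval 0 := by
    rw [hrc, ← Polynomial.coeff_zero_eq_eval_zero]
    simpa using Polynomial.coeff_X_pow_mul r (k+1) 0
  have hq0 : (dh d Q).coeff 0 = 0 := by
    have := congrArg (fun f => Polynomial.coeff f 0) hr
    simpa [pow_succ, Polynomial.coeff_zero_eq_eval_zero] using this
  have hex : ∃ j, (dh d P).coeff j ≠ 0 ∨ (dh d Q).coeff (j+1) ≠ 0 := by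
    refine ⟨k, ?_⟩
    by_contra! h
    rw [h.1, h.2] at hrk
    exact hr0 (by rw [← hrk]; simp)
  have hle : Nat.find hex ≤ k := by
    apply Nat.find_min' hex
    by_contra! h
    rw [h.1, h.2] at hrk
    exact hr0 (by rw [← hrk]; simp)
  have hspec := Nat.find_spec hex
  have hmin : ∀ j < Nat.find hex, (dh d P).coeff j = 0 ∧ (dh d Q).coeff (j+1) = 0 := by
    intro j hj
    have := Nat.find_min hex hj
    push Not at this
    exact this
  generalize Nat.find hex = κ at hle hspec hmin
  set p := (dh d P).coeff κ with hp
  set q := (dh d Q).coeff (κ+1) with hq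
  have hPc : ∀ j ≤ d, P.coeff (ex (d - j) j) = (dh d P).coeff j := by
    intro j hj; rw [dh_coeff, if_pos hj]
  have hQc : ∀ j ≤ d, Q.coeff (ex (d - j) j) = (dh d Q).coeff j := by
    intro j hj; rw [dh_coeff, if_pos hj]
  have hIntg := rescale_int P Q d κ hP hQ hc (by omega)
    (fun j hj => by rw [hPc j (by omega)]; exact (hmin j hj).1)
    (fun j hj => by
      rw [hQc j (by omega)]
      rcases j with _ | j
      · exact hq0
      · exact (hmin j (by omega)).2)
    p q (by rw [hPc κ (by omega)]) (by rw [hQc (κ+1) (by omega)])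
  have hb : ((d - 1 - κ : ℕ) : ℂ) = d - 1 - κ := by
    rw [Nat.cast_sub (by omega), Nat.cast_sub (by omega)]; simp
  rw [hb] at hIntg
  have hpq : p ≠ q := by
    intro h
    rw [← h] at hIntg hspec
    have hp0 : p ≠ 0 := by tauto
    have e : p * (d - 1 - κ) + p * κ = p * (d - 1) := by ring
    rw [e] at hIntg
    have hd1 : ((d:ℂ) - 1) ≠ 0 := by
      intro h0
      have : (d:ℂ) = 1 := by linear_combination h0
      have : d = 1 := by exact_mod_cast this
      omega
    obtain ⟨α, -, hα, -⟩ := hIntg (mul_ne_zero hp0 hd1)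
    have h1 : (1:ℂ) = α * (d - 1) := by
      apply mul_left_cancel₀ hp0; linear_combination hα
    have h2 : (1:ℤ) = α * (d - 1) := by exact_mod_cast h1
    have h3 : ((d:ℤ) - 1) ∣ 1 := ⟨α, by linarith⟩
    have := Int.le_of_dvd one_pos h3
    omega
  have hκ : κ = k := by
    by_contra hne
    have hlt : κ < k := by omega
    have := hrc κ
    rw [Polynomial.coeff_X_pow_mul', if_neg (by omega)] at this
    exact hpq (by linear_combination -this)
  subst hκ
  have hdvd : Polynomial.X ^ κ ∣ dh d P :=
    Polynomial.X_pow_dvd_iff.2 fun j hj => (hmin j hj).1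
  obtain ⟨p1, hp1⟩ := hdvd
  refine ⟨p1, hp1, ?_⟩
  have hp10 : p1.eval 0 = p := by
    rw [hp, hp1, ← Polynomial.coeff_zero_eq_eval_zero]
    simpa using (Polynomial.coeff_X_pow_mul p1 κ 0).symm
  rw [hp10, ← hrk]
  have hqp : q - p ≠ 0 := sub_ne_zero.2 hpq.symm
  have hval : -(κ:ℂ) - (d - 1) * (p / (q - p)) = - (p * (d - 1 - κ) + q * κ) / (q - p) := by
    field_simp; ring
  rw [hval]
  by_cases hσ : p * (d - 1 - κ) + q * κ = 0
  · rw [hσ]; simp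
  · obtain ⟨α, β, hα, hβ⟩ := hIntg hσ
    set σ := p * ((d:ℂ) - 1 - κ) + q * κ with hs
    have h1 : (α:ℂ) * (d - 1 - κ) + β * κ = 1 := by
      apply mul_right_cancel₀ hσ
      linear_combination hs - (d - 1 - κ) * hα - κ * hβ
    have h2 : α * ((d:ℤ) - 1 - κ) + β * κ = 1 := by exact_mod_cast h1
    have hab : β ≠ α := by
      rintro rfl; apply hpq; rw [hα, hβ]
    have hval2 : -σ / (q - p) = (((1:ℝ) / (α - β : ℤ) : ℝ) : ℂ) := by
      have e : q - p = (β - α) * σ := by linear_combination hβ - hα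
      have hab' : (β:ℂ) - α ≠ 0 := sub_ne_zero.2 (by exact_mod_cast hab)
      have hab'' : (α:ℂ) - β ≠ 0 := sub_ne_zero.2 (by exact_mod_cast hab.symm)
      rw [e]; push_cast
      field_simp
      ring
    rw [hval2, Complex.ofReal_re]
    obtain ⟨n, hn⟩ : ∃ n, n = α - β := ⟨_, rfl⟩
    rw [← hn]
    have hdR : (3:ℝ) ≤ d := by exact_mod_cast hd
    rcases lt_or_ge 0 n with hpos | hneg
    · have h3 : ((d:ℤ) - 1) * α = 1 + κ * n := by rw [hn]; linear_combination h2
      have hα1 : 1 ≤ α := by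
        by_contra! h
        have : ((d:ℤ) - 1) * α ≤ 0 := mul_nonpos_of_nonneg_of_nonpos (by omega) (by omega)
        have : 0 ≤ (κ:ℤ) * n := by positivity
        omega
      have h4 : (d:ℤ) - 2 ≤ κ * n := by
        have : ((d:ℤ) - 1) * 1 ≤ ((d:ℤ) - 1) * α := by
          apply mul_le_mul_of_nonneg_left hα1; omega
        omega
      have h5 : (d:ℝ) - 2 ≤ κ * n := by exact_mod_cast h4
      have hnR : (0:ℝ) < n := by exact_mod_cast hpos
      rw [mul_one_div, div_le_iff₀ hnR]; exact h5
    · have : (1:ℝ) / n ≤ 0 := by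
        apply div_nonpos_of_nonneg_of_nonpos zero_le_one; exact_mod_cast hneg
      have h6 : ((d:ℝ) - 2) * (1 / n) ≤ 0 :=
        mul_nonpos_of_nonneg_of_nonpos (by linarith) this
      exact h6.trans (Nat.cast_nonneg _)

lemma local_root (P Q : MvPolynomial (Fin 2) ℂ) (d k : ℕ) (hP : P.totalDegree ≤ d)
    (hQ : Q.totalDegree ≤ d) (hc : IsCompleteVF (fun z => (pev P z, pev Q z)))
    (hd : 3 ≤ d) (hk : k + 1 ≤ d) (u : ℂ) (r : Polynomial ℂ)
    (hr : dh d Q - Polynomial.X * dh d P = (Polynomial.X - Polynomial.C u) ^ (k+1) * r)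
    (hr0 : r.eval u ≠ 0) :
    ∃ p, dh d P = (Polynomial.X - Polynomial.C u) ^ k * p ∧
      ((d:ℝ) - 2) * (-(k:ℂ) - (d - 1) * (p.eval u / r.eval u)).re ≤ k := by
  have hc' := complete_lsub (P := P) (Q := Q) 1 0 u 1 (by ring) hc
  have hr' : dh d (MvPolynomial.C 1 * lsub 1 0 u 1 Q - MvPolynomial.C u * lsub 1 0 u 1 P) -
      Polynomial.X * dh d (MvPolynomial.C 1 * lsub 1 0 u 1 P - MvPolynomial.C 0 * lsub 1 0 u 1 Q) =
      Polynomial.X ^ (k+1) * r.comp (Polynomial.X + Polynomial.C u) := by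
    simp only [dh_sub, dh_C_mul, dh_shift]
    have := congrArg (fun f => f.comp (Polynomial.X + Polynomial.C u)) hr
    simp only [Polynomial.sub_comp, Polynomial.mul_comp, Polynomial.X_comp, Polynomial.pow_comp,
      Polynomial.C_comp, add_sub_cancel_right] at this
    rw [← this]; simp only [map_one, map_zero]; ring
  obtain ⟨p, hp, hle⟩ := local_zero _ _ d k (deg_comb hP hQ _ _ _ _ _ _)
    (deg_comb hQ hP _ _ _ _ _ _) hc' hd hk (r.comp (Polynomial.X + Polynomial.C u)) hr' (by simpa)
  refine ⟨p.comp (Polynomial.X - Polynomial.C u), ?_, ?_⟩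
  · rw [dh_sub, dh_C_mul, dh_C_mul, dh_shift] at hp
    simp only [map_one, one_mul, map_zero, zero_mul, sub_zero] at hp
    have := congrArg (fun f => f.comp (Polynomial.X - Polynomial.C u)) hp
    simpa [Polynomial.comp_assoc] using this
  · simpa using hle

lemma dh_coeff_zero (d : ℕ) (P : MvPolynomial (Fin 2) ℂ) {j : ℕ} (hj : d < j) :
    (dh d P).coeff j = 0 := by
  rw [dh_coeff, if_neg (by omega)]

/-- The polynomial of singular directions at infinity. -/
def rr (d : ℕ) (P Q : MvPolynomial (Fin 2) ℂ) : Polynomial ℂ := dh d Q - Polynomial.X * dh d P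

lemma rr_coeff_top (d : ℕ) (P Q : MvPolynomial (Fin 2) ℂ) :
    (rr d P Q).coeff (d+1) = - (dh d P).coeff d := by
  simp [rr, dh_coeff_zero d Q (Nat.lt_succ_self d)]

lemma rr_natDegree_le (d : ℕ) (P Q : MvPolynomial (Fin 2) ℂ) :
    (rr d P Q).natDegree ≤ d + 1 := by
  rw [Polynomial.natDegree_le_iff_coeff_eq_zero]
  intro j hj
  obtain ⟨j, rfl⟩ : ∃ i, j = i + 1 := ⟨j - 1, by omega⟩
  simp [rr, dh_coeff_zero d Q (show d < j + 1 by omega), dh_coeff_zero d P (show d < j by omega)]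

lemma core_count (P Q : MvPolynomial (Fin 2) ℂ) (d : ℕ) (hP : P.totalDegree ≤ d)
    (hQ : Q.totalDegree ≤ d) (hc : IsCompleteVF (fun z => (pev P z, pev Q z)))
    (hd : 3 ≤ d) (htop : (dh d P).coeff d ≠ 0) :
    (rr d P Q).roots.toFinset.card ≤ 3 := by
  classical
  set p := dh d P with hp
  set r := rr d P Q with hr
  have hrtop : r.coeff (d+1) = - p.coeff d := rr_coeff_top d P Q
  have hr0 : r ≠ 0 := by
    intro h; rw [h] at hrtop; simp at hrtop; exact htop hrtop
  have hrdeg : r.natDegree = d + 1 :=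
    le_antisymm (rr_natDegree_le d P Q)
      (Polynomial.le_natDegree_of_ne_zero (by rw [hrtop]; exact neg_ne_zero.2 htop))
  have hpdeg : p.natDegree = d := by
    apply le_antisymm
    · rw [Polynomial.natDegree_le_iff_coeff_eq_zero]
      exact fun j hj => dh_coeff_zero d P hj
    · exact Polynomial.le_natDegree_of_ne_zero htop
  set Z := r.roots.toFinset with hZ
  set c := r.leadingCoeff with hcdef
  have hcv : c = - p.coeff d := by rw [hcdef, Polynomial.leadingCoeff, hrdeg, hrtop]
  have hc0 : c ≠ 0 := by rw [hcv]; exact neg_ne_zero.2 htop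
  set m : ℂ → ℕ := fun u => r.rootMultiplicity u with hm
  have hsplit : r = Polynomial.C c * ∏ u ∈ Z, (Polynomial.X - Polynomial.C u) ^ m u := by
    rw [← Polynomial.prod_multiset_root_eq_finset_root]
    exact (IsAlgClosed.splits r).eq_prod_roots
  have hm1 : ∀ u ∈ Z, 1 ≤ m u := by
    intro u hu
    rw [hZ, Multiset.mem_toFinset, Polynomial.mem_roots hr0] at hu
    exact (Polynomial.rootMultiplicity_pos hr0).2 hu
  have hmsum : ∑ u ∈ Z, m u = d + 1 := by
    have h := congrArg Polynomial.natDegree hsplit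
    rw [hrdeg, Polynomial.natDegree_C_mul hc0,
      Polynomial.natDegree_prod_of_monic _ _ (fun u _ => (Polynomial.monic_X_sub_C u).pow _)] at h
    simpa using h.symm
  by_contra! hN
  have hmd : ∀ u ∈ Z, m u ≤ d := by
    intro u hu
    obtain ⟨v, hv⟩ : (Z.erase u).Nonempty := by
      rw [← Finset.card_pos, Finset.card_erase_of_mem hu]; omega
    have h1 := Finset.add_sum_erase Z m hu
    have h2 : m v ≤ ∑ x ∈ Z.erase u, m x := Finset.single_le_sum (fun _ _ => Nat.zero_le _) hv
    have h3 := hm1 v (Finset.mem_of_mem_erase hv)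
    omega
  set k : ℂ → ℕ := fun u => m u - 1 with hk
  have hkm : ∀ u ∈ Z, m u = k u + 1 := fun u hu => by have := hm1 u hu; simp only [hk]; omega
  have hksum : ∑ u ∈ Z, k u + Z.card = d + 1 := by
    rw [← hmsum, Finset.sum_congr rfl hkm, Finset.sum_add_distrib]; simp
  have hloc : ∀ u ∈ Z, ∃ pu, p = (Polynomial.X - Polynomial.C u) ^ k u * pu ∧
      ((d:ℝ) - 2) * (-(k u:ℂ) - (d - 1) * (pu.eval u /
        (c * ∏ v ∈ Z.erase u, (u - v) ^ m v))).re ≤ k u := by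
    intro u hu
    have hev : (Polynomial.C c * ∏ v ∈ Z.erase u, (Polynomial.X - Polynomial.C v) ^ m v).eval u =
        c * ∏ v ∈ Z.erase u, (u - v) ^ m v := by
      simp [Polynomial.eval_prod]
    have := local_root P Q d (k u) hP hQ hc hd (by rw [← hkm u hu]; exact hmd u hu) u
      (Polynomial.C c * ∏ v ∈ Z.erase u, (Polynomial.X - Polynomial.C v) ^ m v) ?_ ?_
    · rw [hev] at this; exact this
    · change r = _
      conv_lhs => rw [hsplit]
      rw [← Finset.mul_prod_erase Z _ hu, hkm u hu]; ring
    · rw [hev]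
      refine mul_ne_zero hc0 (Finset.prod_ne_zero_iff.2 fun v hv => pow_ne_zero _ ?_)
      exact sub_ne_zero.2 (Finset.ne_of_mem_erase hv).symm
  set D := ∏ u ∈ Z, (Polynomial.X - Polynomial.C u) ^ k u with hD
  have hDm : D.Monic := Polynomial.monic_prod_of_monic _ _
    (fun u _ => (Polynomial.monic_X_sub_C u).pow _)
  have hDdeg : D.natDegree = ∑ u ∈ Z, k u := by
    rw [hD, Polynomial.natDegree_prod_of_monic _ _ (fun u _ => (Polynomial.monic_X_sub_C u).pow _)]
    simp
  obtain ⟨pt, hpt⟩ : D ∣ p := by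
    apply Finset.prod_dvd_of_coprime
    · intro u _ v _ huv
      exact (Polynomial.pairwise_coprime_X_sub_C Function.injective_id huv).pow
    · intro u hu
      obtain ⟨pu, h, -⟩ := hloc u hu
      exact ⟨pu, h⟩
  have hpt0 : pt ≠ 0 := by
    rintro rfl
    rw [mul_zero] at hpt
    rw [hpt] at htop; simp at htop
  have hptdeg : pt.natDegree = Z.card - 1 := by
    have := hDm.natDegree_mul' hpt0
    rw [← hpt, hpdeg, hDdeg] at this
    omega
  have hptc : pt.coeff (Z.card - 1) = -c := by
    have h1 := Polynomial.leadingCoeff_monic_mul (q := pt) hDm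
    rw [← hpt, Polynomial.leadingCoeff, Polynomial.leadingCoeff, hpdeg, hptdeg] at h1
    rw [← h1, hcv, neg_neg]
  have hlag := Lagrange.coeff_eq_sum (s := Z) (v := id) (F := ℂ) (Function.injective_id.injOn)
    (P := pt) (by
      rw [Polynomial.degree_eq_natDegree hpt0, hptdeg]
      exact_mod_cast (by omega : Z.card - 1 < Z.card))
  simp only [id] at hlag
  rw [hptc] at hlag
  have hineq : ∀ u ∈ Z, ((d:ℝ) - 2) * (-(k u:ℂ) - (d - 1) * (pt.eval u /
        (∏ v ∈ Z.erase u, (u - v)) / c)).re ≤ k u := by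
    intro u hu
    obtain ⟨pu, h1, h2⟩ := hloc u hu
    have e1 : pu = (∏ v ∈ Z.erase u, (Polynomial.X - Polynomial.C v) ^ k v) * pt := by
      have h3 : (Polynomial.X - Polynomial.C u) ^ k u * pu = (Polynomial.X - Polynomial.C u) ^ k u *
          ((∏ v ∈ Z.erase u, (Polynomial.X - Polynomial.C v) ^ k v) * pt) := by
        rw [← h1, hpt, hD, ← Finset.mul_prod_erase Z _ hu]; ring
      exact mul_left_cancel₀ (pow_ne_zero _ (Polynomial.X_sub_C_ne_zero u)) h3
    have e2 : pu.eval u / (c * ∏ v ∈ Z.erase u, (u - v) ^ m v) =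
        pt.eval u / (∏ v ∈ Z.erase u, (u - v)) / c := by
      have e3 : ∏ v ∈ Z.erase u, (u - v) ^ m v =
          (∏ v ∈ Z.erase u, (u - v) ^ k v) * ∏ v ∈ Z.erase u, (u - v) := by
        rw [← Finset.prod_mul_distrib]
        refine Finset.prod_congr rfl fun v hv => ?_
        rw [hkm v (Finset.mem_of_mem_erase hv), pow_succ]
      have n1 : ∏ v ∈ Z.erase u, (u - v) ≠ 0 := Finset.prod_ne_zero_iff.2 fun v hv =>
        sub_ne_zero.2 (Finset.ne_of_mem_erase hv).symm
      have n2 : ∏ v ∈ Z.erase u, (u - v) ^ k v ≠ 0 := Finset.prod_ne_zero_iff.2 fun v hv =>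
        pow_ne_zero _ (sub_ne_zero.2 (Finset.ne_of_mem_erase hv).symm)
      rw [e3, e1]
      simp only [Polynomial.eval_mul, Polynomial.eval_prod, Polynomial.eval_pow,
        Polynomial.eval_sub, Polynomial.eval_X, Polynomial.eval_C]
      field_simp
    rw [← e2]; exact h2
  have hsum := Finset.sum_le_sum hineq
  rw [← Finset.mul_sum, ← Complex.re_sum, Finset.sum_sub_distrib, Finset.sum_neg_distrib,
    ← Finset.mul_sum, ← Finset.sum_div, ← hlag, neg_div, div_self hc0] at hsum
  have hkC : ((∑ u ∈ Z, k u : ℕ) : ℝ) = d + 1 - Z.card := by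
    have : ((∑ u ∈ Z, k u + Z.card : ℕ) : ℝ) = ((d + 1 : ℕ) : ℝ) := by rw [hksum]
    push_cast at this ⊢; linarith
  have e1 : (-∑ u ∈ Z, (k u : ℂ) - ((d:ℂ) - 1) * -1) =
      (((-(∑ u ∈ Z, k u : ℕ) + (d - 1) : ℝ)) : ℂ) := by
    push_cast; ring
  rw [e1, Complex.ofReal_re, ← Nat.cast_sum, hkC] at hsum
  have hdR : (3:ℝ) ≤ d := by exact_mod_cast hd
  have hNR : (4:ℝ) ≤ Z.card := by exact_mod_cast hN
  nlinarith

lemma pev_hom {P : MvPolynomial (Fin 2) ℂ} {n : ℕ} (h : P.IsHomogeneous n) (t x y : ℂ) :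
    pev P (t * x, t * y) = t ^ n * pev P (x, y) := by
  rw [pev_eq, pev_eq, Finset.mul_sum]
  refine Finset.sum_congr rfl fun m hm => ?_
  have : m 0 + m 1 = n := by
    have := h (MvPolynomial.mem_support_iff.1 hm)
    rw [← degree_two, Finsupp.degree_eq_weight_one]; exact this
  rw [← this, mul_pow, mul_pow, pow_add]; ring

lemma pev_hc_inf (d : ℕ) (P : MvPolynomial (Fin 2) ℂ) :
    pev (MvPolynomial.homogeneousComponent d P) (0, 1) = (dh d P).coeff d := by
  rw [pev_eq, dh_coeff, if_pos le_rfl, Nat.sub_self, Finset.sum_eq_single (ex 0 d)]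
  · rw [ex_zero, MvPolynomial.coeff_homogeneousComponent, degree_two, ex_zero, ex_one]
    simp
  · intro m hm hne
    rw [MvPolynomial.support_homogeneousComponent, Finset.mem_filter, degree_two] at hm
    have : m 0 ≠ 0 := by
      intro h0; apply hne; rw [eq_ex m, h0]; congr 1; omega
    simp [this]
  · intro h
    rw [MvPolynomial.notMem_support_iff.1 h]; simp

lemma rr_eval (d : ℕ) (P Q : MvPolynomial (Fin 2) ℂ) (v : ℂ) :
    (rr d P Q).eval v = pev (MvPolynomial.homogeneousComponent d Q) (1, v) -
      v * pev (MvPolynomial.homogeneousComponent d P) (1, v) := by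
  simp [rr, dh_eval]

lemma rr_ne_zero (d : ℕ) (P Q : MvPolynomial (Fin 2) ℂ)
    (hinv : MvPolynomial.X 0 * MvPolynomial.homogeneousComponent d Q ≠
      MvPolynomial.X 1 * MvPolynomial.homogeneousComponent d P) : rr d P Q ≠ 0 := by
  intro h0
  apply hinv
  apply MvPolynomial.funext
  intro z
  have hz : z = ![z 0, z 1] := by ext i; fin_cases i <;> rfl
  have hev : ∀ R : MvPolynomial (Fin 2) ℂ, MvPolynomial.eval z R = pev R (z 0, z 1) := by
    intro R; rw [pev, ← hz]
  rw [map_mul, map_mul, MvPolynomial.eval_X, MvPolynomial.eval_X, hev, hev]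
  generalize z 0 = x
  generalize z 1 = y
  have hPh := MvPolynomial.homogeneousComponent_isHomogeneous d P
  have hQh := MvPolynomial.homogeneousComponent_isHomogeneous d Q
  by_cases hx : x = 0
  · have h1 := rr_coeff_top d P Q
    rw [h0, Polynomial.coeff_zero] at h1
    have h2 := pev_hom hPh y 0 1
    rw [pev_hc_inf, neg_eq_zero.1 h1.symm] at h2
    simp at h2
    rw [hx, h2]; simp
  · have h1 := rr_eval d P Q (y / x)
    rw [h0, Polynomial.eval_zero] at h1
    have h2 := pev_hom hPh x 1 (y / x)
    have h3 := pev_hom hQh x 1 (y / x)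
    rw [mul_one, mul_div_cancel₀ _ hx] at h2 h3
    rw [h2, h3]
    have h4 : y = x * (y / x) := by field_simp
    generalize y / x = u at *
    rw [h4]
    linear_combination (-x * x ^ d) * h1

lemma count_all (P Q : MvPolynomial (Fin 2) ℂ) (d : ℕ) (hP : P.totalDegree ≤ d)
    (hQ : Q.totalDegree ≤ d) (hc : IsCompleteVF (fun z => (pev P z, pev Q z)))
    (hr0 : rr d P Q ≠ 0) :
    (rr d P Q).roots.toFinset.card ≤ 3 ∧
    ((dh d P).coeff d = 0 → (rr d P Q).roots.toFinset.card ≤ 2) := by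
  classical
  rcases lt_or_ge d 3 with hd | hd
  · have h1 : (rr d P Q).roots.toFinset.card ≤ (rr d P Q).natDegree :=
      (Multiset.toFinset_card_le _).trans (Polynomial.card_roots' _)
    refine ⟨h1.trans ((rr_natDegree_le d P Q).trans (by omega)), fun h => h1.trans ?_⟩
    have h2 : (rr d P Q).natDegree ≤ d := by
      rw [Polynomial.natDegree_le_iff_coeff_eq_zero]
      intro j hj
      rcases (Nat.succ_le_of_lt hj).eq_or_lt with h3 | h3
      · rw [← h3, Nat.succ_eq_add_one, rr_coeff_top, h, neg_zero]
      · exact Polynomial.natDegree_le_iff_coeff_eq_zero.1 (rr_natDegree_le d P Q) j h3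
    omega
  · obtain ⟨b, hb⟩ : ∃ b, b ∉ insert 0 (rr d P Q).roots.toFinset :=
      Infinite.exists_notMem_finset _
    rw [Finset.mem_insert, Multiset.mem_toFinset, Polynomial.mem_roots hr0, not_or] at hb
    obtain ⟨hb0, hbr⟩ := hb
    set a := 1 / b with ha
    have ha0 : a ≠ 0 := one_div_ne_zero hb0
    have hab : a * b = 1 := by rw [ha]; field_simp
    have hPh := MvPolynomial.homogeneousComponent_isHomogeneous d P
    have hQh := MvPolynomial.homogeneousComponent_isHomogeneous d Q
    set fP := pev (MvPolynomial.homogeneousComponent d P) with hfP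
    set fQ := pev (MvPolynomial.homogeneousComponent d Q) with hfQ
    set P' := MvPolynomial.C 1 * lsub 1 a 0 1 P - MvPolynomial.C a * lsub 1 a 0 1 Q with hP'
    set Q' := MvPolynomial.C 1 * lsub 1 a 0 1 Q - MvPolynomial.C 0 * lsub 1 a 0 1 P with hQ'
    have hc' : IsCompleteVF (fun z => (pev P' z, pev Q' z)) :=
      complete_lsub 1 a 0 1 (by ring) hc
    have hdP' : P'.totalDegree ≤ d := deg_comb hP hQ _ _ _ _ _ _
    have hdQ' : Q'.totalDegree ≤ d := deg_comb hQ hP _ _ _ _ _ _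
    have hPv : ∀ x y, pev (MvPolynomial.homogeneousComponent d P') (x, y) =
        fP (x + a * y, y) - a * fQ (x + a * y, y) := by
      intro x y
      rw [hP', map_sub, MvPolynomial.homogeneousComponent_C_mul,
        MvPolynomial.homogeneousComponent_C_mul, lsub_hc, lsub_hc]
      have h1 := pev_lsub 1 a 0 1 (MvPolynomial.homogeneousComponent d P) x y
      have h2 := pev_lsub 1 a 0 1 (MvPolynomial.homogeneousComponent d Q) x y
      simp only [one_mul, zero_mul, zero_add] at h1 h2
      rw [hfP, hfQ, ← h1, ← h2]
      simp [pev]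
    have hQv : ∀ x y, pev (MvPolynomial.homogeneousComponent d Q') (x, y) =
        fQ (x + a * y, y) := by
      intro x y
      rw [hQ', map_sub, MvPolynomial.homogeneousComponent_C_mul,
        MvPolynomial.homogeneousComponent_C_mul, lsub_hc, lsub_hc]
      have h2 := pev_lsub 1 a 0 1 (MvPolynomial.homogeneousComponent d Q) x y
      simp only [one_mul, zero_mul, zero_add] at h2
      rw [hfQ, ← h2]
      simp [pev]
    have htop : (dh d P').coeff d ≠ 0 := by
      rw [← pev_hc_inf, hPv]
      intro h
      apply hbr
      rw [Polynomial.IsRoot.def, rr_eval]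
      have h1 := pev_hom hPh a 1 b
      have h2 := pev_hom hQh a 1 b
      rw [hab, mul_one] at h1 h2
      rw [zero_add, mul_one] at h
      have h3 : a * a ^ d * (fQ (1, b) - b * fP (1, b)) = 0 := by
        linear_combination -h + h1 - a * h2 - (a ^ d * fP (1, b)) * hab
      rcases mul_eq_zero.1 h3 with h4 | h4
      · exact absurd h4 (mul_ne_zero ha0 (pow_ne_zero _ ha0))
      · exact h4
    have hcount := core_count P' Q' d hdP' hdQ' hc' hd htop
    have hr0' : rr d P' Q' ≠ 0 := by
      intro h
      have := rr_coeff_top d P' Q'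
      rw [h, Polynomial.coeff_zero] at this
      exact htop (neg_eq_zero.1 this.symm)
    have hrv : ∀ v, (rr d P' Q').eval v = (1 + a * v) * fQ (1 + a * v, v) -
        v * fP (1 + a * v, v) := by
      intro v
      rw [rr_eval, hPv, hQv]; ring
    set φ : ℂ → ℂ := fun u => u / (1 - a * u) with hφ
    have hne : ∀ u ∈ (rr d P Q).roots.toFinset, 1 - a * u ≠ 0 := by
      intro u hu h
      rw [Multiset.mem_toFinset, Polynomial.mem_roots hr0] at hu
      have : u = b := by
        apply mul_left_cancel₀ ha0
        linear_combination -h - hab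
      exact hbr (this ▸ hu)
    have hinj : Set.InjOn φ (rr d P Q).roots.toFinset := by
      intro u hu v hv h
      have h1 := hne u hu
      have h2 := hne v hv
      simp only [hφ] at h
      rw [div_eq_div_iff h1 h2] at h
      linear_combination h
    have hcard : ((rr d P Q).roots.toFinset.image φ).card = (rr d P Q).roots.toFinset.card :=
      Finset.card_image_of_injOn hinj
    have hsub : (rr d P Q).roots.toFinset.image φ ⊆ (rr d P' Q').roots.toFinset := by
      intro v hv
      obtain ⟨u, hu, rfl⟩ := Finset.mem_image.1 hv
      have h1 := hne u hu
      rw [Multiset.mem_toFinset, Polynomial.mem_roots hr0] at hu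
      rw [Multiset.mem_toFinset, Polynomial.mem_roots hr0', Polynomial.IsRoot.def, hrv]
      rw [Polynomial.IsRoot.def, rr_eval] at hu
      have e1 : 1 + a * φ u = (1 - a * u)⁻¹ * 1 := by simp only [hφ]; field_simp; ring
      have e2 : φ u = (1 - a * u)⁻¹ * u := by simp only [hφ]; field_simp
      rw [e1, e2, hfP, hfQ, pev_hom hPh, pev_hom hQh]
      linear_combination ((1 - a * u)⁻¹ * (1 - a * u)⁻¹ ^ d) * hu
    refine ⟨?_, fun h => ?_⟩
    · rw [← hcard]; exact (Finset.card_le_card hsub).trans hcount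
    · have hnew : -b ∉ (rr d P Q).roots.toFinset.image φ := by
        intro hmem
        obtain ⟨u, hu, hh⟩ := Finset.mem_image.1 hmem
        have h1 := hne u hu
        simp only [hφ] at hh
        rw [div_eq_iff h1] at hh
        exact hb0 (by linear_combination hh + u * hab)
      have hsub2 : insert (-b) ((rr d P Q).roots.toFinset.image φ) ⊆ (rr d P' Q').roots.toFinset := by
        refine Finset.insert_subset ?_ hsub
        rw [Multiset.mem_toFinset, Polynomial.mem_roots hr0', Polynomial.IsRoot.def, hrv]
        have e : 1 + a * -b = 0 := by linear_combination -hab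
        have h2 := pev_hom hPh (-b) 0 1
        rw [pev_hc_inf, h, mul_zero, mul_zero, mul_one] at h2
        rw [e, hfP, h2]; ring
      have := (Finset.card_le_card hsub2).trans hcount
      rw [Finset.card_insert_of_notMem hnew, hcard] at this
      omega

/-- Homogenization in a chart at infinity. -/
def hz (d : ℕ) (P : MvPolynomial (Fin 2) ℂ) (i : Fin 2) (w : C2) : ℂ :=
  ∑ m ∈ P.support, P.coeff m * (w.1 ^ (d - (m 0 + m 1)) * w.2 ^ m i)

lemma hz_analytic (d : ℕ) (P : MvPolynomial (Fin 2) ℂ) (i : Fin 2) (w : C2) :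
    AnalyticAt ℂ (hz d P i) w := by
  unfold hz
  apply Finset.analyticAt_fun_sum
  intro m _
  exact analyticAt_const.mul ((analyticAt_fst.pow _).mul (analyticAt_snd.pow _))

lemma hz_one (d : ℕ) (P : MvPolynomial (Fin 2) ℂ) (hP : P.totalDegree ≤ d) (x y : ℂ) (hx : x ≠ 0) :
    pev P (1 / x, y / x) = hz d P 1 (x, y) / x ^ d := by
  rw [pev_eq, hz, Finset.sum_div]
  refine Finset.sum_congr rfl fun m hm => ?_
  obtain ⟨e, he⟩ := Nat.exists_eq_add_of_le (le_of_mem_support hP hm)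
  have : d - (m 0 + m 1) = e := by omega
  simp only [this]
  rw [he, pow_add, pow_add, div_pow, div_pow, one_pow]
  field_simp

lemma hz_zero (d : ℕ) (P : MvPolynomial (Fin 2) ℂ) (hP : P.totalDegree ≤ d) (x y : ℂ) (hx : x ≠ 0) :
    pev P (y / x, 1 / x) = hz d P 0 (x, y) / x ^ d := by
  rw [pev_eq, hz, Finset.sum_div]
  refine Finset.sum_congr rfl fun m hm => ?_
  obtain ⟨e, he⟩ := Nat.exists_eq_add_of_le (le_of_mem_support hP hm)
  have : d - (m 0 + m 1) = e := by omega
  simp only [this]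
  rw [he, pow_add, pow_add, div_pow, div_pow, one_pow]
  field_simp

lemma hz_inf (d : ℕ) (P : MvPolynomial (Fin 2) ℂ) (hP : P.totalDegree ≤ d) (v : ℂ) :
    hz d P 1 (0, v) = pev (MvPolynomial.homogeneousComponent d P) (1, v) := by
  rw [pev_eq, hz, MvPolynomial.support_homogeneousComponent, Finset.sum_filter]
  refine Finset.sum_congr rfl fun m hm => ?_
  have := le_of_mem_support hP hm
  rw [MvPolynomial.coeff_homogeneousComponent, degree_two]
  split_ifs with h
  · simp [h]
  · have : d - (m 0 + m 1) ≠ 0 := by omega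
    simp [zero_pow this]

lemma hz_inf2 (d : ℕ) (P : MvPolynomial (Fin 2) ℂ) (hP : P.totalDegree ≤ d) :
    hz d P 0 (0, 0) = (dh d P).coeff d := by
  rw [dh_coeff, if_pos le_rfl, Nat.sub_self, hz, Finset.sum_eq_single (ex 0 d)]
  · simp [ex_zero, ex_one]
  · intro m hm hne
    have h1 := le_of_mem_support hP hm
    by_cases h0 : m 0 = 0
    · have : d - (m 0 + m 1) ≠ 0 := by
        intro h; apply hne; rw [eq_ex m, h0]; congr 1; omega
      simp [zero_pow this]
    · simp [zero_pow h0]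
  · intro h
    rw [MvPolynomial.notMem_support_iff.1 h]; simp

lemma regular_of (X ψ : C2 → C2) (p : C2) (V : C2 → C2) (hV : ∀ w, AnalyticAt ℂ V w)
    (h0 : V p ≠ 0) (ht : ∀ w, w.1 ≠ 0 → det2 (fderiv ℂ ψ w (V w)) (X (ψ w)) = 0) :
    RegularPtAtInf X ψ p := by
  have h1 : ∀ᶠ w in nhds p, V w ≠ 0 := (hV p).continuousAt.eventually_ne h0
  obtain ⟨ρ, hρ, h2⟩ := Metric.eventually_nhds_iff_ball.1 h1
  exact ⟨ρ, V, hρ, fun w _ => hV w, h2, fun w _ hw => ht w hw⟩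

lemma fd_inv (w : C2) (hw : w.1 ≠ 0) :
    HasFDerivAt (fun w : C2 => 1 / w.1)
      ((-(w.1 ^ 2)⁻¹) • ContinuousLinearMap.fst ℂ ℂ ℂ) w := by
  have h := (hasDerivAt_inv hw).comp_hasFDerivAt w (hasFDerivAt_fst (𝕜 := ℂ) (E := ℂ) (F := ℂ) (p := w))
  simpa [Function.comp_def] using h

lemma fd_div (w : C2) (hw : w.1 ≠ 0) :
    HasFDerivAt (fun w : C2 => w.2 / w.1)
      (w.2 • ((-(w.1 ^ 2)⁻¹) • ContinuousLinearMap.fst ℂ ℂ ℂ) +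
        (1 / w.1) • ContinuousLinearMap.snd ℂ ℂ ℂ) w := by
  have h := (hasFDerivAt_snd (𝕜 := ℂ) (E := ℂ) (F := ℂ) (p := w)).mul (fd_inv w hw)
  have e : (fun w : C2 => w.2 / w.1) = fun w => w.2 * (1 / w.1) := by
    funext w; ring
  rw [e]; exact h

lemma regular1 (P Q : MvPolynomial (Fin 2) ℂ) (X : C2 → C2)
    (hX : ∀ z, X z = (pev P z, pev Q z)) (d : ℕ) (hP : P.totalDegree ≤ d)
    (hQ : Q.totalDegree ≤ d) (v : ℂ) (hv : (rr d P Q).eval v ≠ 0) :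
    RegularPtAtInf X chart1 (0, v) := by
  refine regular_of X chart1 (0, v)
    (fun w => (-w.1 * hz d P 1 w, hz d Q 1 w - w.2 * hz d P 1 w)) ?_ ?_ ?_
  · intro w
    have h1 := hz_analytic d P 1 w
    have h2 := hz_analytic d Q 1 w
    exact (analyticAt_fst.neg.mul h1).prod (h2.sub (analyticAt_snd.mul h1))
  · intro h
    apply hv
    rw [rr_eval, ← hz_inf d P hP, ← hz_inf d Q hQ]
    exact (Prod.ext_iff.1 h).2
  · rintro ⟨x, y⟩ hx
    have h1 : HasFDerivAt chart1 _ (x, y) := (fd_inv (x, y) hx).prodMk (fd_div (x, y) hx)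
    rw [h1.fderiv, hX]
    simp only [chart1]
    rw [hz_one d P hP x y hx, hz_one d Q hQ x y hx]
    simp only [det2, ContinuousLinearMap.prod_apply, add_apply,
      smul_apply, ContinuousLinearMap.coe_fst', ContinuousLinearMap.coe_snd', smul_eq_mul]
    change x ≠ 0 at hx
    field_simp
    ring

lemma regular2 (P Q : MvPolynomial (Fin 2) ℂ) (X : C2 → C2)
    (hX : ∀ z, X z = (pev P z, pev Q z)) (d : ℕ) (hP : P.totalDegree ≤ d)
    (hQ : Q.totalDegree ≤ d) (hv : (dh d P).coeff d ≠ 0) :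
    RegularPtAtInf X chart2 (0, 0) := by
  refine regular_of X chart2 (0, 0)
    (fun w => (-w.1 * hz d Q 0 w, hz d P 0 w - w.2 * hz d Q 0 w)) ?_ ?_ ?_
  · intro w
    have h1 := hz_analytic d P 0 w
    have h2 := hz_analytic d Q 0 w
    exact (analyticAt_fst.neg.mul h2).prod (h1.sub (analyticAt_snd.mul h2))
  · intro h
    apply hv
    rw [← hz_inf2 d P hP]
    simpa using (Prod.ext_iff.1 h).2
  · rintro ⟨x, y⟩ hx
    have h1 : HasFDerivAt chart2 _ (x, y) := (fd_div (x, y) hx).prodMk (fd_inv (x, y) hx)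
    rw [h1.fderiv, hX]
    simp only [chart2]
    rw [hz_zero d P hP x y hx, hz_zero d Q hQ x y hx]
    simp only [det2, ContinuousLinearMap.prod_apply, add_apply,
      smul_apply, ContinuousLinearMap.coe_fst', ContinuousLinearMap.coe_snd', smul_eq_mul]
    change x ≠ 0 at hx
    field_simp
    ring

/-- The line at infinity (when invariant) contains at most 3 singular points of the
foliation induced on ℂP² by a complete polynomial vector field.  The singular points at
infinity are the non-regular points in the two standard charts at infinity. -/
theorem at_most_three_singularities_at_infinity
    (P Q : MvPolynomial (Fin 2) ℂ) (X : C2 → C2)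
    (hX : ∀ z, X z = (pev P z, pev Q z))
    (hcomp : IsCompleteVF X)
    (d : ℕ) (hd : d = max P.totalDegree Q.totalDegree)
    -- the line at infinity is invariant by F_X
    (hinv : MvPolynomial.X 0 * MvPolynomial.homogeneousComponent d Q ≠
      MvPolynomial.X 1 * MvPolynomial.homogeneousComponent d P) :
    {v : ℂ | ¬ RegularPtAtInf X chart1 ((0 : ℂ), v)}.Finite ∧
    {v : ℂ | ¬ RegularPtAtInf X chart1 ((0 : ℂ), v)}.ncard ≤ 3 ∧
    (¬ RegularPtAtInf X chart2 ((0 : ℂ), (0 : ℂ)) →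
      {v : ℂ | ¬ RegularPtAtInf X chart1 ((0 : ℂ), v)}.ncard ≤ 2) := by
  have hP : P.totalDegree ≤ d := hd ▸ le_max_left _ _
  have hQ : Q.totalDegree ≤ d := hd ▸ le_max_right _ _
  have hr0 := rr_ne_zero d P Q hinv
  have hc : IsCompleteVF (fun z => (pev P z, pev Q z)) := by
    rwa [show X = fun z => (pev P z, pev Q z) from funext hX] at hcomp
  obtain ⟨h3, h2⟩ := count_all P Q d hP hQ hc hr0
  have hsub : {v : ℂ | ¬ RegularPtAtInf X chart1 ((0 : ℂ), v)} ⊆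
      ((rr d P Q).roots.toFinset : Set ℂ) := by
    intro v hv
    rw [Finset.mem_coe, Multiset.mem_toFinset, Polynomial.mem_roots hr0]
    by_contra hne
    exact hv (regular1 P Q X hX d hP hQ v hne)
  have hcard : {v : ℂ | ¬ RegularPtAtInf X chart1 ((0 : ℂ), v)}.ncard ≤
      (rr d P Q).roots.toFinset.card := by
    rw [← Set.ncard_coe_finset]
    exact Set.ncard_le_ncard hsub (Finset.finite_toSet _)
  refine ⟨(Finset.finite_toSet _).subset hsub, hcard.trans h3, fun hns => hcard.trans (h2 ?_)⟩
  by_contra hne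
  exact hns (regular2 P Q X hX d hP hQ hne)

end
end
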